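/- arXiv:1209.4958 — 2 statements merged into one kernel-verified Lean document; each statement's English description precedes it below -/
import Mathlib

section
/- With K, 𝔟, ω = [[a₀,…,a_{r−1}]], ℓ, α_i, β_i, Q as in the context (in particular α_{−2} = 1, β_{−2} = −a₀, α_{−1} = 0, β_{−1} = 1, and the indices of a are read modulo r, so a_ℓ = a₀), for every integer k ≥ 0 one has ζ(−k,𝔟) = Σ_{i=0}^{ℓ−1} (−1)^{i−1}·[L_k(∂_{h₁},∂_{h₂}) applied to the polynomial Q(α_i h₁ − α_{i−1} h₂, β_i h₁ − β_{i−1} h₂)^k, evaluated at (h₁,h₂) = (0,0)] + (B_{2k+2}/(2k+2)!)·Σ_{i=0}^{ℓ−1} (−1)^i·a_{ℓ−i}·[R_k(∂_{h₁},∂_{h₂}) applied to the polynomial Q(α_{i−2} h₁ + α_i h₂, β_{i−2} h₁ + β_i h₂)^k, evaluated at (0,0)]. -/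
open NumberField
open scoped nonZeroDivisors
open Classical

noncomputable section

/-- The weight function of the (oriented) lattice cone spanned by `v₁, v₂`:
`1` on interior lattice points, `1/2` on nonzero lattice points of the boundary rays,
`0` elsewhere. -/
def wt (v₁ v₂ : ℝ × ℝ) (m : ℤ × ℤ) : ℝ :=
  if ∃ x₁ x₂ : ℝ, 0 < x₁ ∧ 0 < x₂ ∧ ((m.1 : ℝ), (m.2 : ℝ)) = x₁ • v₁ + x₂ • v₂ then 1
  else if ∃ t : ℝ, 0 < t ∧
      (((m.1 : ℝ), (m.2 : ℝ)) = t • v₁ ∨ ((m.1 : ℝ), (m.2 : ℝ)) = t • v₂) then 1 / 2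
  else 0

/-- first-coordinate partial derivative of a function on `ℝ × ℝ`. -/
def pd1 (f : ℝ × ℝ → ℝ) : ℝ × ℝ → ℝ := fun p => deriv (fun x => f (x, p.2)) p.1

/-- second-coordinate partial derivative of a function on `ℝ × ℝ`. -/
def pd2 (f : ℝ × ℝ → ℝ) : ℝ × ℝ → ℝ := fun p => deriv (fun y => f (p.1, y)) p.2

/-! ### Part 1: Euler-Maclaurin summation -/

/-- `B_n / n!` -/
def bet (n : ℕ) : ℝ := (bernoulli n : ℝ) / (n.factorial : ℝ)

lemma bet_odd (n : ℕ) (hn : 1 ≤ n) : bet (2 * n + 1) = 0 := by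
  unfold bet
  rw [bernoulli_eq_zero_of_odd ⟨n, rfl⟩ (by omega)]
  simp

/-- `B_n(x)/n!` -/
def bfun (n : ℕ) (x : ℝ) : ℝ := bernoulliFun n x / (n.factorial : ℝ)

lemma bfun_hasDeriv (n : ℕ) (x : ℝ) : HasDerivAt (bfun (n + 1)) (bfun n x) x := by
  unfold bfun
  have h := (hasDerivAt_bernoulliFun (n + 1) x).div_const ((n + 1).factorial : ℝ)
  refine h.congr_deriv ?_
  have : (n.factorial : ℝ) ≠ 0 := by positivity
  have : ((n : ℝ) + 1) ≠ 0 := by positivity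
  simp only [Nat.factorial_succ, Nat.add_sub_cancel]
  push_cast
  field_simp

lemma bfun_cont (n : ℕ) : Continuous (bfun n) := by
  unfold bfun
  exact (continuous_bernoulliFun n).div_const _

lemma bfun_zero (n : ℕ) : bfun n 0 = bet n := by
  unfold bfun bet
  rw [bernoulliFun_eval_zero]

lemma bfun_one (n : ℕ) (hn : n ≠ 1) : bfun n 1 = bet n := by
  unfold bfun bet
  rw [bernoulliFun_endpoints_eq_of_ne_one hn, bernoulliFun_eval_zero]

lemma em_parts (g : ℕ → ℝ → ℂ) (hg : ∀ n, ∀ y ∈ Set.Icc (0 : ℝ) 1, HasDerivAt (g n) (g (n + 1) y) y)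
    (n : ℕ) :
    ∫ x in (0 : ℝ)..1, (bfun n x : ℂ) * g n x =
      (bfun (n + 1) 1 : ℂ) * g n 1 - (bfun (n + 1) 0 : ℂ) * g n 0 -
        ∫ x in (0 : ℝ)..1, (bfun (n + 1) x : ℂ) * g (n + 1) x := by
  have hc : ∀ n, ContinuousOn (g n) (Set.Icc (0 : ℝ) 1) := fun n y hy =>
    (hg n y hy).continuousAt.continuousWithinAt
  have h := intervalIntegral.integral_mul_deriv_eq_deriv_mul (a := (0 : ℝ)) (b := 1)
    (u := fun x => g n x) (u' := fun x => g (n + 1) x)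
    (v := fun x => (bfun (n + 1) x : ℂ)) (v' := fun x => (bfun n x : ℂ))
    (fun x hx => hg n x (by rwa [Set.uIcc_of_le zero_le_one] at hx))
    (fun x _ => (bfun_hasDeriv n x).ofReal_comp)
    ((hc (n + 1)).intervalIntegrable_of_Icc zero_le_one)
    ((Complex.continuous_ofReal.comp (bfun_cont n)).intervalIntegrable _ _)
  simp only [mul_comm (g _ _)] at h
  exact h

lemma em_unit (g : ℕ → ℝ → ℂ) (hg : ∀ n, ∀ y ∈ Set.Icc (0 : ℝ) 1, HasDerivAt (g n) (g (n + 1) y) y)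
    (p : ℕ) :
    (g 0 0 + g 0 1) / 2 = (∫ x in (0 : ℝ)..1, g 0 x)
      + ∑ i ∈ Finset.range (p + 1), (bet (2 * i + 2) : ℂ) * (g (2 * i + 1) 1 - g (2 * i + 1) 0)
      - ∫ x in (0 : ℝ)..1, (bfun (2 * p + 2) x : ℂ) * g (2 * p + 2) x := by
  induction p with
  | zero =>
    have h0 := em_parts g hg 0
    have h1 := em_parts g hg 1
    have e0 : ∀ x, bfun 0 x = 1 := by intro x; simp [bfun]
    have e1 : bfun 1 1 = 1 / 2 := by simp [bfun]; norm_num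
    have e2 : bfun 1 0 = -1 / 2 := by simp [bfun]; norm_num
    simp only [e0, zero_add, e1, e2] at h0
    simp only [Nat.reduceAdd, bfun_one 2 (by norm_num), bfun_zero] at h1
    simp only [Finset.range_one, zero_add, Finset.sum_singleton, mul_zero]
    rw [h1] at h0
    push_cast at h0
    simp only [one_mul] at h0
    rw [h0]
    ring
  | succ p ih =>
    rw [ih, Finset.sum_range_succ _ (p + 1)]
    have h0 := em_parts g hg (2 * p + 2)
    have h1 := em_parts g hg (2 * p + 2 + 1)
    rw [bfun_one _ (by omega), bfun_zero] at h0 h1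
    have e : bet (2 * p + 2 + 1) = 0 := by
      have := bet_odd (p + 1) (by omega)
      rwa [show 2 * (p + 1) + 1 = 2 * p + 2 + 1 by ring] at this
    rw [h1, e] at h0
    rw [h0]
    have e3 : 2 * (p + 1) + 2 = 2 * p + 2 + 1 + 1 := by ring
    have e4 : 2 * (p + 1) + 1 = 2 * p + 2 + 1 := by ring
    rw [e3, e4]
    push_cast
    ring

lemma bfun_bound (n : ℕ) : ∃ C : ℝ, 0 ≤ C ∧ ∀ x ∈ Set.Icc (0 : ℝ) 1, |bfun n x| ≤ C := by
  obtain ⟨C, hC⟩ := isCompact_Icc.exists_bound_of_continuousOn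
    (s := Set.Icc (0 : ℝ) 1) (bfun_cont n).continuousOn
  exact ⟨max C 0, le_max_right _ _, fun x hx => (hC x hx).trans (le_max_left _ _)⟩

/-- trapezoidal sum -/
def trap (M : ℕ) (h : ℕ → ℂ) : ℂ := ∑ n ∈ Finset.range M, (h n + h (n + 1)) / 2

theorem euler_maclaurin (p : ℕ) : ∃ C : ℝ, 0 ≤ C ∧
    ∀ (a : ℕ) (g : ℕ → ℝ → ℂ), (∀ n, ∀ y ∈ Set.Icc (0 : ℝ) a, HasDerivAt (g n) (g (n + 1) y) y) →
    ∀ K : ℝ, (∀ y ∈ Set.Icc (0 : ℝ) a, ‖g (2 * p + 2) y‖ ≤ K) → ∀ m : ℕ, 1 ≤ m →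
    ‖trap (a * m) (fun n => g 0 ((n : ℝ) / m)) - (m : ℂ) * (∫ y in (0 : ℝ)..a, g 0 y)
      - ∑ i ∈ Finset.range (p + 1), (bet (2 * i + 2) : ℂ) * (m : ℂ)⁻¹ ^ (2 * i + 1) *
          (g (2 * i + 1) a - g (2 * i + 1) 0)‖ ≤ C * a * K * (m : ℝ)⁻¹ ^ (2 * p + 1) := by
  obtain ⟨C, hC0, hC⟩ := bfun_bound (2 * p + 2)
  refine ⟨C, hC0, fun a g hg K hK m hm => ?_⟩
  have hm0 : (0 : ℝ) < m := by exact_mod_cast hm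
  have hmC : (m : ℂ) ≠ 0 := by exact_mod_cast hm0.ne'
  have hcont : ContinuousOn (g 0) (Set.Icc (0 : ℝ) a) := fun y hy =>
    (hg 0 y hy).continuousAt.continuousWithinAt
  -- points stay in the interval
  have hmem : ∀ n ∈ Finset.range (a * m), ∀ x ∈ Set.Icc (0 : ℝ) 1,
      (n : ℝ) / m + (m : ℝ)⁻¹ * x ∈ Set.Icc (0 : ℝ) a := by
    intro n hn x hx
    rw [Finset.mem_range] at hn
    have hn' : (n : ℝ) + 1 ≤ a * m := by exact_mod_cast hn
    refine ⟨by have := hx.1; positivity, ?_⟩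
    have : (n : ℝ) / m + (m : ℝ)⁻¹ * x = (n + x) / m := by field_simp
    rw [this, div_le_iff₀ hm0]
    linarith [hx.2]
  set rem : ℕ → ℂ := fun n => ∫ x in (0 : ℝ)..1, (bfun (2 * p + 2) x : ℂ) *
    ((m : ℂ)⁻¹ ^ (2 * p + 2) * g (2 * p + 2) ((n : ℝ) / m + (m : ℝ)⁻¹ * x)) with hrem
  have key : ∀ n ∈ Finset.range (a * m),
      (g 0 ((n : ℝ) / m) + g 0 (((n + 1 : ℕ) : ℝ) / m)) / 2 =
      (m : ℂ) * (∫ y in ((n : ℝ) / m)..(((n + 1 : ℕ) : ℝ) / m), g 0 y) +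
      ∑ i ∈ Finset.range (p + 1), (bet (2 * i + 2) : ℂ) * (m : ℂ)⁻¹ ^ (2 * i + 1) *
        (g (2 * i + 1) (((n + 1 : ℕ) : ℝ) / m) - g (2 * i + 1) ((n : ℝ) / m)) - rem n := by
    intro n hn
    have hn1 : (((n + 1 : ℕ) : ℝ) / m) = (n : ℝ) / m + (m : ℝ)⁻¹ * 1 := by
      push_cast; field_simp
    have hu := em_unit (fun j x => (m : ℂ)⁻¹ ^ j * g j ((n : ℝ) / m + (m : ℝ)⁻¹ * x)) ?_ p
    · simp only [pow_zero, one_mul, mul_zero, add_zero] at hu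
      rw [hn1, hu]
      have hintg := intervalIntegral.integral_comp_add_mul (a := (0 : ℝ)) (b := 1)
        (fun y => g 0 y) (c := (m : ℝ)⁻¹) (by positivity) ((n : ℝ) / m)
      rw [hintg]
      simp only [mul_zero, add_zero, inv_inv]
      congr 1
      have e5 : ∀ z : ℂ, (m : ℝ) • z = (m : ℂ) * z := fun z => by rw [Complex.real_smul]; simp
      rw [e5]
      congr 1
      · apply Finset.sum_congr rfl
        intro i _
        ring
    · intro j y hy
      have h1 := (hg j _ (hmem n hn y hy))
      have h2 : HasDerivAt (fun x : ℝ => (n : ℝ) / m + (m : ℝ)⁻¹ * x) ((m : ℝ)⁻¹) y := by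
        simpa using ((hasDerivAt_id y).const_mul ((m : ℝ)⁻¹)).const_add ((n : ℝ) / m)
      have h3 := (h1.scomp y h2).const_mul ((m : ℂ)⁻¹ ^ j)
      refine h3.congr_deriv ?_
      rw [Complex.real_smul]
      push_cast
      ring
  have hsum : trap (a * m) (fun n => g 0 ((n : ℝ) / m)) =
      (m : ℂ) * (∫ y in (0 : ℝ)..a, g 0 y) +
      ∑ i ∈ Finset.range (p + 1), (bet (2 * i + 2) : ℂ) * (m : ℂ)⁻¹ ^ (2 * i + 1) *
          (g (2 * i + 1) a - g (2 * i + 1) 0) - ∑ n ∈ Finset.range (a * m), rem n := by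
    unfold trap
    rw [Finset.sum_congr rfl key, Finset.sum_sub_distrib, Finset.sum_add_distrib]
    have ham : ((a * m : ℕ) : ℝ) / m = a := by push_cast; field_simp
    congr 1
    congr 1
    · rw [← Finset.mul_sum, intervalIntegral.sum_integral_adjacent_intervals
        (a := fun n : ℕ => (n : ℝ) / m)]
      · rw [ham]; simp
      · intro n hn
        have hle : (n : ℝ) / m ≤ ((n + 1 : ℕ) : ℝ) / m := by
          push_cast; gcongr; linarith
        apply ContinuousOn.intervalIntegrable_of_Icc hle
        apply hcont.mono
        apply Set.Icc_subset_Icc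
        · positivity
        · rw [div_le_iff₀ hm0]; exact_mod_cast hn
    · rw [Finset.sum_comm]
      apply Finset.sum_congr rfl
      intro i _
      rw [← Finset.mul_sum, Finset.sum_range_sub (fun n : ℕ => g (2 * i + 1) ((n : ℝ) / m)), ham]
      simp
  have hremb : ∀ n ∈ Finset.range (a * m), ‖rem n‖ ≤ C * ((m : ℝ)⁻¹ ^ (2 * p + 2) * K) := by
    intro n hn
    have := intervalIntegral.norm_integral_le_of_norm_le_const (a := (0 : ℝ)) (b := 1)
      (f := fun x => (bfun (2 * p + 2) x : ℂ) *
        ((m : ℂ)⁻¹ ^ (2 * p + 2) * g (2 * p + 2) ((n : ℝ) / m + (m : ℝ)⁻¹ * x)))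
      (C := C * ((m : ℝ)⁻¹ ^ (2 * p + 2) * K)) ?_
    · rw [sub_zero, abs_one, mul_one] at this
      exact this
    · intro x hx
      rw [Set.uIoc_of_le zero_le_one] at hx
      have hx' : x ∈ Set.Icc (0 : ℝ) 1 := ⟨hx.1.le, hx.2⟩
      rw [norm_mul, norm_mul]
      gcongr
      · rw [Complex.norm_real]; exact hC x hx'
      · simp
      · exact hK _ (hmem n hn x hx')
  have hfin : ‖∑ n ∈ Finset.range (a * m), rem n‖ ≤ (a * m : ℕ) * (C * ((m : ℝ)⁻¹ ^ (2 * p + 2) * K)) := by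
    refine (norm_sum_le_of_le _ hremb).trans ?_
    simp
  rw [hsum]
  have e : ∀ x y z : ℂ, x + y - z - x - y = -z := by intros; ring
  rw [e, norm_neg]
  refine hfin.trans (le_of_eq ?_)
  push_cast
  rw [pow_succ _ (2 * p + 1)]
  field_simp

/-! ### Part 2: directional derivatives of `Q ^ (-s)` -/

/-- the binomial coefficient `binom` -/
def bc (s : ℂ) : ℕ → ℂ
  | 0 => 1
  | l + 1 => (-s - l) / (l + 1) * bc s l

lemma bc_succ (s : ℂ) (l : ℕ) : ((l + 1 : ℕ) : ℂ) * bc s (l + 1) = (-s - l) * bc s l := by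
  have : ((l : ℂ) + 1) ≠ 0 := by exact_mod_cast Nat.succ_ne_zero l
  rw [bc]
  push_cast
  field_simp

lemma bc_diff (l : ℕ) : Differentiable ℂ (fun s => bc s l) := by
  induction l with
  | zero => simp only [bc]; fun_prop
  | succ l ih => simp only [bc]; fun_prop

lemma bc_neg_nat (k l : ℕ) : bc (-(k : ℂ)) l = (Nat.choose k l : ℂ) := by
  induction l with
  | zero => simp [bc]
  | succ l ih =>
    have h := bc_succ (-(k : ℂ)) l
    rw [ih] at h
    have h0 : (((l + 1 : ℕ)) : ℂ) ≠ 0 := by exact_mod_cast Nat.succ_ne_zero l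
    apply mul_left_cancel₀ h0
    rw [h]
    have h2 := Nat.choose_succ_right_eq k l
    rcases le_or_gt l k with hlk | hlk
    · have h3 : ((k.choose (l + 1) * (l + 1) : ℕ) : ℂ) = ((k.choose l * (k - l) : ℕ) : ℂ) := by
        rw [h2]
      push_cast [Nat.cast_sub hlk] at h3 ⊢
      linear_combination -h3
    · rw [Nat.choose_eq_zero_of_lt hlk, Nat.choose_eq_zero_of_lt (by omega)]
      simp

/-- coefficient of the product of two binomial series -/
def cc (n : ℕ) (s r r' : ℂ) : ℂ :=
  ∑ p ∈ Finset.HasAntidiagonal.antidiagonal n, bc s p.1 * bc s p.2 * r ^ p.1 * r' ^ p.2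

def cc1 (n : ℕ) (s r r' : ℂ) : ℂ :=
  ∑ p ∈ Finset.HasAntidiagonal.antidiagonal n, bc s p.1 * bc s p.2 * (p.1 * r ^ (p.1 - 1)) * r' ^ p.2

def cc2 (n : ℕ) (s r r' : ℂ) : ℂ :=
  ∑ p ∈ Finset.HasAntidiagonal.antidiagonal n, bc s p.1 * bc s p.2 * r ^ p.1 * (p.2 * r' ^ (p.2 - 1))

lemma cc1_succ (n : ℕ) (s r r' : ℂ) : cc1 (n + 1) s r r' =
    ∑ p ∈ Finset.HasAntidiagonal.antidiagonal n, (-s - p.1) * (bc s p.1 * bc s p.2 * r ^ p.1 * r' ^ p.2) := by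
  unfold cc1
  rw [Finset.Nat.sum_antidiagonal_succ]
  simp only [Nat.cast_zero, zero_mul, mul_zero, zero_add, Nat.add_sub_cancel]
  apply Finset.sum_congr rfl
  rintro ⟨l, m⟩ _
  have := bc_succ s l
  simp only
  linear_combination (bc s m * r ^ l * r' ^ m) * this

lemma cc2_succ (n : ℕ) (s r r' : ℂ) : cc2 (n + 1) s r r' =
    ∑ p ∈ Finset.HasAntidiagonal.antidiagonal n, (-s - p.2) * (bc s p.1 * bc s p.2 * r ^ p.1 * r' ^ p.2) := by
  unfold cc2
  rw [Finset.Nat.sum_antidiagonal_succ']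
  simp only [Nat.cast_zero, zero_mul, mul_zero, zero_add, add_zero, Nat.add_sub_cancel]
  apply Finset.sum_congr rfl
  rintro ⟨l, m⟩ _
  have := bc_succ s m
  simp only
  linear_combination (bc s l * r ^ l * r' ^ m) * this

lemma nat_mul_pow_pred (l : ℕ) (r : ℂ) : (l : ℂ) * r ^ (l - 1) * r = l * r ^ l := by
  cases l with
  | zero => simp
  | succ l => simp [pow_succ]; ring

lemma cc1_mul (n : ℕ) (s r r' : ℂ) : r * cc1 n s r r' =
    ∑ p ∈ Finset.HasAntidiagonal.antidiagonal n, p.1 * (bc s p.1 * bc s p.2 * r ^ p.1 * r' ^ p.2) := by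
  unfold cc1
  rw [Finset.mul_sum]
  apply Finset.sum_congr rfl
  rintro ⟨l, m⟩ _
  have := nat_mul_pow_pred l r
  simp only
  linear_combination (bc s l * bc s m * r' ^ m) * this

lemma cc2_mul (n : ℕ) (s r r' : ℂ) : r' * cc2 n s r r' =
    ∑ p ∈ Finset.HasAntidiagonal.antidiagonal n, p.2 * (bc s p.1 * bc s p.2 * r ^ p.1 * r' ^ p.2) := by
  unfold cc2
  rw [Finset.mul_sum]
  apply Finset.sum_congr rfl
  rintro ⟨l, m⟩ _
  have := nat_mul_pow_pred m r'
  simp only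
  linear_combination (bc s l * bc s m * r ^ l) * this

lemma cc_euler (n : ℕ) (s r r' : ℂ) :
    (n : ℂ) * cc n s r r' = r * cc1 n s r r' + r' * cc2 n s r r' := by
  rw [cc1_mul, cc2_mul, ← Finset.sum_add_distrib]
  unfold cc
  rw [Finset.mul_sum]
  apply Finset.sum_congr rfl
  rintro ⟨l, m⟩ h
  rw [Finset.HasAntidiagonal.mem_antidiagonal] at h
  simp only at h ⊢
  rw [← h]
  push_cast
  ring

lemma cc_rec (n : ℕ) (s r r' : ℂ) : ((n + 1 : ℕ) : ℂ) * cc (n + 1) s r r' =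
    -s * (r + r') * cc n s r r' - r ^ 2 * cc1 n s r r' - r' ^ 2 * cc2 n s r r' := by
  rw [cc_euler, cc1_succ, cc2_succ]
  have h1 := cc1_mul n s r r'
  have h2 := cc2_mul n s r r'
  rw [show r ^ 2 * cc1 n s r r' = r * (r * cc1 n s r r') by ring,
    show r' ^ 2 * cc2 n s r r' = r' * (r' * cc2 n s r r') by ring, h1, h2]
  unfold cc
  simp only [Finset.mul_sum, ← Finset.sum_add_distrib, ← Finset.sum_sub_distrib]
  apply Finset.sum_congr rfl
  intro p _
  ring

lemma cc_trans (n : ℕ) (s r r' : ℂ) :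
    cc1 (n + 1) s r r' + cc2 (n + 1) s r r' = (-2 * s - n) * cc n s r r' := by
  rw [cc1_succ, cc2_succ, ← Finset.sum_add_distrib]
  unfold cc
  rw [Finset.mul_sum]
  apply Finset.sum_congr rfl
  rintro ⟨l, m⟩ h
  rw [Finset.HasAntidiagonal.mem_antidiagonal] at h
  simp only at h ⊢
  rw [← h]
  push_cast
  ring

lemma cc_hasDeriv (n : ℕ) (s : ℂ) (f g : ℝ → ℂ) (f' g' : ℂ) (y : ℝ)
    (hf : HasDerivAt f f' y) (hg : HasDerivAt g g' y) :
    HasDerivAt (fun y => cc n s (f y) (g y))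
      (f' * cc1 n s (f y) (g y) + g' * cc2 n s (f y) (g y)) y := by
  have h : ∀ p ∈ Finset.HasAntidiagonal.antidiagonal n, HasDerivAt
      (fun y => bc s p.1 * bc s p.2 * f y ^ p.1 * g y ^ p.2)
      (bc s p.1 * bc s p.2 * (p.1 * f y ^ (p.1 - 1) * f') * g y ^ p.2 +
        bc s p.1 * bc s p.2 * f y ^ p.1 * (p.2 * g y ^ (p.2 - 1) * g')) y := by
    intro p _
    exact ((hf.pow p.1).const_mul (bc s p.1 * bc s p.2)).mul (hg.pow p.2)
  have h2 := HasDerivAt.fun_sum h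
  unfold cc
  refine h2.congr_deriv ?_
  unfold cc1 cc2
  rw [Finset.mul_sum, Finset.mul_sum, ← Finset.sum_add_distrib]
  apply Finset.sum_congr rfl
  intro p _
  ring

lemma cc_cont (n : ℕ) : Continuous (fun q : ℂ × ℂ × ℂ => cc n q.1 q.2.1 q.2.2) := by
  unfold cc
  apply continuous_finset_sum
  intro p _
  have h1 : Continuous (fun q : ℂ × ℂ × ℂ => bc q.1 p.1) :=
    (bc_diff p.1).continuous.comp continuous_fst
  have h2 : Continuous (fun q : ℂ × ℂ × ℂ => bc q.1 p.2) :=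
    (bc_diff p.2).continuous.comp continuous_fst
  fun_prop

lemma cc_diff (n : ℕ) (r r' : ℂ) : Differentiable ℂ (fun s => cc n s r r') := by
  unfold cc
  apply Differentiable.fun_sum
  intro p _
  have h1 := bc_diff p.1
  have h2 := bc_diff p.2
  fun_prop

/-- iterated directional derivative of the power of the norm form -/
def TT (n : ℕ) (s : ℂ) (N X X' w w' : ℝ) : ℂ :=
  (n.factorial : ℂ) * (Complex.exp (-s * (Real.log (N * X * X') : ℂ)) *
    cc n s ((w / X : ℝ) : ℂ) ((w' / X' : ℝ) : ℂ))

lemma TT_zero (s : ℂ) (N X X' w w' : ℝ) :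
    TT 0 s N X X' w w' = Complex.exp (-s * (Real.log (N * X * X') : ℂ)) := by
  simp [TT, cc, bc]

lemma TT_diff (n : ℕ) (N X X' w w' : ℝ) : Differentiable ℂ (fun s => TT n s N X X' w w') := by
  unfold TT
  have := cc_diff n ((w / X : ℝ) : ℂ) ((w' / X' : ℝ) : ℂ)
  fun_prop

lemma TT_scale (n : ℕ) (s : ℂ) (N X X' w w' e e' : ℝ) (h : e * e' = 1) :
    TT n s N (e * X) (e' * X') (e * w) (e' * w') = TT n s N X X' w w' := by
  have he : e ≠ 0 := by rintro rfl; simp at h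
  have he' : e' ≠ 0 := by rintro rfl; simp at h
  unfold TT
  rw [mul_div_mul_left _ _ he, mul_div_mul_left _ _ he',
    show N * (e * X) * (e' * X') = (e * e') * (N * X * X') by ring, h, one_mul]

lemma TT_hasDeriv (n : ℕ) (s : ℂ) (N A A' B B' y : ℝ) (hN : 0 < N) (h1 : 0 < A + y * B)
    (h2 : 0 < A' + y * B') :
    HasDerivAt (fun y : ℝ => TT n s N (A + y * B) (A' + y * B') B B')
      (TT (n + 1) s N (A + y * B) (A' + y * B') B B') y := by
  have d1 : HasDerivAt (fun y : ℝ => A + y * B) B y := by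
    simpa using ((hasDerivAt_id y).mul_const B).const_add A
  have d2 : HasDerivAt (fun y : ℝ => A' + y * B') B' y := by
    simpa using ((hasDerivAt_id y).mul_const B').const_add A'
  have r1 : HasDerivAt (fun y : ℝ => ((B / (A + y * B) : ℝ) : ℂ))
      ((-(B / (A + y * B)) ^ 2 : ℝ) : ℂ) y := by
    refine HasDerivAt.ofReal_comp ?_
    refine ((hasDerivAt_const y B).div d1 h1.ne').congr_deriv ?_
    field_simp
    ring
  have r2 : HasDerivAt (fun y : ℝ => ((B' / (A' + y * B') : ℝ) : ℂ))
      ((-(B' / (A' + y * B')) ^ 2 : ℝ) : ℂ) y := by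
    refine HasDerivAt.ofReal_comp ?_
    refine ((hasDerivAt_const y B').div d2 h2.ne').congr_deriv ?_
    field_simp
    ring
  have lg : HasDerivAt (fun y : ℝ => ((Real.log (N * (A + y * B) * (A' + y * B')) : ℝ) : ℂ))
      ((B / (A + y * B) + B' / (A' + y * B') : ℝ) : ℂ) y := by
    refine HasDerivAt.ofReal_comp ?_
    have d3 : HasDerivAt (fun y : ℝ => N * (A + y * B) * (A' + y * B'))
        (N * B * (A' + y * B') + N * (A + y * B) * B') y := (d1.const_mul N).mul d2
    refine (d3.log (by positivity)).congr_deriv ?_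
    rw [div_add_div _ _ h1.ne' h2.ne', div_eq_div_iff (by positivity) (by positivity)]
    ring
  have ex := (lg.const_mul (-s)).cexp
  have c := cc_hasDeriv n s _ _ _ _ y r1 r2
  refine ((ex.mul c).const_mul (n.factorial : ℂ)).congr_deriv ?_
  unfold TT
  have hr := cc_rec n s ((B / (A + y * B) : ℝ) : ℂ) ((B' / (A' + y * B') : ℝ) : ℂ)
  rw [Nat.factorial_succ]
  push_cast at hr ⊢
  linear_combination (-(n.factorial : ℂ) *
    Complex.exp (-s * (Real.log (N * (A + y * B) * (A' + y * B')) : ℂ))) * hr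

lemma TT_trans_hasDeriv (n : ℕ) (s : ℂ) (N X X' w w' τ : ℝ) (h1 : X ≠ 0) (h2 : X' ≠ 0) :
    HasDerivAt (fun τ : ℝ => TT (n + 1) s N X X' (w + τ * X) (w' + τ * X'))
      ((n + 1) * (-2 * s - n) * TT n s N X X' (w + τ * X) (w' + τ * X')) τ := by
  have r1 : ∀ (w X : ℝ), X ≠ 0 → HasDerivAt (fun τ : ℝ => (((w + τ * X) / X : ℝ) : ℂ)) (1 : ℝ) τ := by
    intro w X h1
    refine HasDerivAt.ofReal_comp ?_
    refine ((((hasDerivAt_id τ).mul_const X).const_add w).div_const X).congr_deriv ?_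
    field_simp
  have c := cc_hasDeriv (n + 1) s _ _ _ _ τ (r1 w X h1) (r1 w' X' h2)
  unfold TT
  refine ((c.const_mul (Complex.exp (-s * (Real.log (N * X * X') : ℂ)))).const_mul
    ((n + 1).factorial : ℂ)).congr_deriv ?_
  have hr := cc_trans n s (((w + τ * X) / X : ℝ) : ℂ) (((w' + τ * X') / X' : ℝ) : ℂ)
  rw [Nat.factorial_succ]
  push_cast at hr ⊢
  linear_combination ((n + 1) * (n.factorial : ℂ) *
    Complex.exp (-s * (Real.log (N * X * X') : ℂ))) * hr

lemma TT_trans_cont (n : ℕ) (N X X' w w' : ℝ) :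
    Continuous (fun q : ℂ × ℝ => TT n q.1 N X X' (w + q.2 * X) (w' + q.2 * X')) := by
  unfold TT
  have h : Continuous (fun q : ℂ × ℝ =>
      ((q.1, (((w + q.2 * X) / X : ℝ) : ℂ), (((w' + q.2 * X') / X' : ℝ) : ℂ)) : ℂ × ℂ × ℂ)) := by
    refine continuous_fst.prodMk (Continuous.prodMk ?_ ?_)
    · exact Complex.continuous_ofReal.comp (by fun_prop)
    · exact Complex.continuous_ofReal.comp (by fun_prop)
  have h2 := (cc_cont n).comp h
  simp only [Function.comp_def] at h2
  fun_prop

lemma TT_trans_sub (n : ℕ) (s : ℂ) (N X X' w w' a : ℝ) (h1 : X ≠ 0) (h2 : X' ≠ 0) :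
    TT (n + 1) s N X X' (w + a * X) (w' + a * X') - TT (n + 1) s N X X' w w' =
      (n + 1) * (-2 * s - n) * ∫ τ in (0 : ℝ)..a, TT n s N X X' (w + τ * X) (w' + τ * X') := by
  have hc : Continuous (fun τ : ℝ => TT n s N X X' (w + τ * X) (w' + τ * X')) :=
    (TT_trans_cont n N X X' w w').comp (f := fun τ : ℝ => (s, τ)) (by fun_prop)
  have := intervalIntegral.integral_eq_sub_of_hasDerivAt (a := 0) (b := a)
    (fun τ _ => TT_trans_hasDeriv n s N X X' w w' τ h1 h2)
    (Continuous.intervalIntegrable (by fun_prop) _ _)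
  rw [intervalIntegral.integral_const_mul] at this
  rw [this]
  simp

lemma TT_cont (n : ℕ) (N A A' B B' a : ℝ) (hN : 0 < N)
    (h1 : ∀ y ∈ Set.Icc (0 : ℝ) a, 0 < A + y * B) (h2 : ∀ y ∈ Set.Icc (0 : ℝ) a, 0 < A' + y * B') :
    ContinuousOn (fun q : ℂ × ℝ => TT n q.1 N (A + q.2 * B) (A' + q.2 * B') B B')
      (Set.univ ×ˢ Set.Icc (0 : ℝ) a) := by
  unfold TT
  have e1 : ∀ q ∈ (Set.univ : Set ℂ) ×ˢ Set.Icc (0 : ℝ) a, A + q.2 * B ≠ 0 :=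
    fun q hq => (h1 q.2 hq.2).ne'
  have e2 : ∀ q ∈ (Set.univ : Set ℂ) ×ˢ Set.Icc (0 : ℝ) a, A' + q.2 * B' ≠ 0 :=
    fun q hq => (h2 q.2 hq.2).ne'
  have h : ContinuousOn (fun q : ℂ × ℝ =>
      ((q.1, ((B / (A + q.2 * B) : ℝ) : ℂ), ((B' / (A' + q.2 * B') : ℝ) : ℂ)) : ℂ × ℂ × ℂ))
      (Set.univ ×ˢ Set.Icc (0 : ℝ) a) := by
    refine continuousOn_fst.prodMk (ContinuousOn.prodMk ?_ ?_)
    · exact Complex.continuous_ofReal.comp_continuousOn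
        (ContinuousOn.div (by fun_prop) (by fun_prop) e1)
    · exact Complex.continuous_ofReal.comp_continuousOn
        (ContinuousOn.div (by fun_prop) (by fun_prop) e2)
  have h2 := (cc_cont n).comp_continuousOn h
  simp only [Function.comp_def] at h2
  have h3 : ContinuousOn (fun q : ℂ × ℝ => ((Real.log (N * (A + q.2 * B) * (A' + q.2 * B')) : ℝ) : ℂ))
      (Set.univ ×ˢ Set.Icc (0 : ℝ) a) := by
    refine Complex.continuous_ofReal.comp_continuousOn (ContinuousOn.log (by fun_prop) ?_)
    intro q hq
    exact mul_ne_zero (mul_ne_zero hN.ne' (e1 q hq)) (e2 q hq)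
  fun_prop

/-- coefficient of the k-th power of the norm form -/
def coef (k n : ℕ) (X X' w w' : ℝ) : ℝ :=
  ∑ p ∈ Finset.HasAntidiagonal.antidiagonal n,
    ((k.choose p.1 : ℝ) * w ^ p.1 * X ^ (k - p.1)) * ((k.choose p.2 : ℝ) * w' ^ p.2 * X' ^ (k - p.2))

lemma choose_div_pow (k l : ℕ) (X w : ℝ) (hX : X ≠ 0) :
    X ^ k * ((k.choose l : ℝ) * (w / X) ^ l) = (k.choose l : ℝ) * w ^ l * X ^ (k - l) := by
  rcases le_or_gt l k with h | h
  · obtain ⟨d, rfl⟩ := Nat.exists_eq_add_of_le h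
    rw [Nat.add_sub_cancel_left, div_pow, pow_add]
    field_simp
  · simp [Nat.choose_eq_zero_of_lt h]

lemma TT_neg_nat (k n : ℕ) (N X X' w w' : ℝ) (hN : 0 < N) (h1 : 0 < X) (h2 : 0 < X') :
    TT n (-(k : ℂ)) N X X' w w' = ((n.factorial * (N ^ k * coef k n X X' w w') : ℝ) : ℂ) := by
  unfold TT
  have he : Complex.exp (-(-(k : ℂ)) * (Real.log (N * X * X') : ℂ)) = (((N * X * X') ^ k : ℝ) : ℂ) := by
    rw [neg_neg, Complex.exp_nat_mul, ← Complex.ofReal_exp, Real.exp_log (by positivity)]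
    push_cast; rfl
  rw [he]
  have hc : (N * X * X') ^ k * ∑ p ∈ Finset.HasAntidiagonal.antidiagonal n,
      (k.choose p.1 : ℝ) * (k.choose p.2 : ℝ) * (w / X) ^ p.1 * (w' / X') ^ p.2 =
      N ^ k * coef k n X X' w w' := by
    unfold coef
    rw [Finset.mul_sum, Finset.mul_sum]
    apply Finset.sum_congr rfl
    intro p _
    rw [← choose_div_pow k p.1 X w h1.ne', ← choose_div_pow k p.2 X' w' h2.ne', mul_pow, mul_pow]
    ring
  rw [← hc]
  unfold cc
  simp only [bc_neg_nat]
  push_cast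
  ring

lemma coef_zero_of_lt (k n : ℕ) (hn : 2 * k < n) (X X' w w' : ℝ) : coef k n X X' w w' = 0 := by
  unfold coef
  apply Finset.sum_eq_zero
  rintro ⟨l, m⟩ h
  rw [Finset.HasAntidiagonal.mem_antidiagonal] at h
  simp only at h ⊢
  rcases lt_or_ge k l with h1 | h1
  · simp [Nat.choose_eq_zero_of_lt h1]
  · simp [Nat.choose_eq_zero_of_lt (show k < m by omega)]

lemma coef_expand (k : ℕ) (X X' w w' x y : ℝ) :
    ((x * X + y * w) * (x * X' + y * w')) ^ k =
      ∑ n ∈ Finset.range (2 * k + 1), coef k n X X' w w' * x ^ (2 * k - n) * y ^ n := by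
  have h1 : ∀ X w : ℝ, (x * X + y * w) ^ k = ∑ l ∈ Finset.range (k + 1),
      (k.choose l : ℝ) * w ^ l * X ^ (k - l) * (x ^ (k - l) * y ^ l) := by
    intro X w
    rw [add_comm, add_pow]
    apply Finset.sum_congr rfl
    intro l _
    rw [mul_pow, mul_pow]
    ring
  rw [mul_pow, h1, h1, Finset.sum_mul_sum, ← Finset.sum_product',
    ← Finset.sum_fiberwise_of_maps_to (t := Finset.range (2 * k + 1)) (g := fun p => p.1 + p.2)]
  · apply Finset.sum_congr rfl
    intro n hn
    rw [Finset.mem_range] at hn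
    unfold coef
    rw [Finset.sum_mul, Finset.sum_mul]
    symm
    rw [← Finset.sum_subset (s₁ := (Finset.range (k + 1) ×ˢ Finset.range (k + 1)).filter
      (fun p => p.1 + p.2 = n))]
    · apply Finset.sum_congr rfl
      rintro ⟨l, m⟩ h
      simp only [Finset.mem_filter, Finset.mem_product, Finset.mem_range] at h
      simp only
      obtain ⟨⟨h1, h2⟩, rfl⟩ := h
      rw [show 2 * k - (l + m) = (k - l) + (k - m) by omega, pow_add, pow_add]
      ring
    · rintro ⟨l, m⟩ h
      simp only [Finset.mem_filter] at h
      simpa using h.2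
    · rintro ⟨l, m⟩ h h'
      simp only [Finset.HasAntidiagonal.mem_antidiagonal] at h
      simp only [Finset.mem_filter, Finset.mem_product, Finset.mem_range, not_and] at h'
      simp only
      rcases lt_or_ge k l with h1 | h1
      · simp [Nat.choose_eq_zero_of_lt h1]
      · rcases lt_or_ge k m with h2 | h2
        · simp [Nat.choose_eq_zero_of_lt h2]
        · exact absurd h (h' ⟨by omega, by omega⟩)
  · rintro ⟨l, m⟩ h
    simp only [Finset.mem_product, Finset.mem_range] at h ⊢
    omega

lemma coef_top (k : ℕ) (X X' w w' : ℝ) : coef k (2 * k) X X' w w' = (w * w') ^ k := by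
  have h := coef_expand k X X' w w' 0 1
  rw [Finset.sum_range_succ, Finset.sum_eq_zero] at h
  · simpa using h.symm
  · intro n hn
    rw [Finset.mem_range] at hn
    rw [zero_pow (by omega)]
    simp

/-! ### Part 3: the zeta function of one cone -/

/-- data of a lattice cone spanned by `A` and `A + a B` -/
structure LCone where
  N : ℝ
  A : ℝ
  A' : ℝ
  B : ℝ
  B' : ℝ
  a : ℕ
  hN : 0 < N
  h1 : ∀ y ∈ Set.Icc (0 : ℝ) a, 0 < A + y * B
  h2 : ∀ y ∈ Set.Icc (0 : ℝ) a, 0 < A' + y * B'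

namespace LCone

variable (c : LCone)

def g (s : ℂ) (n : ℕ) (y : ℝ) : ℂ := TT n s c.N (c.A + y * c.B) (c.A' + y * c.B') c.B c.B'

def II (s : ℂ) : ℂ := ∫ y in (0 : ℝ)..c.a, c.g s 0 y

def EE (i : ℕ) (s : ℂ) : ℂ := c.g s (2 * i + 1) c.a - c.g s (2 * i + 1) 0

def tr (m : ℕ) (s : ℂ) : ℂ := trap (c.a * m) (fun n => c.g s 0 ((n : ℝ) / m))

def rm (p m : ℕ) (s : ℂ) : ℂ := c.tr m s - (m : ℂ) * c.II s -
  ∑ i ∈ Finset.range (p + 1), (bet (2 * i + 2) : ℂ) * (m : ℂ)⁻¹ ^ (2 * i + 1) * c.EE i s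

def RR (p : ℕ) (s : ℂ) : ℂ := ∑' m : ℕ, 1 / ((m : ℂ) + 1) ^ (2 * s) * c.rm p (m + 1) s

lemma g_hasDeriv (s : ℂ) (n : ℕ) (y : ℝ) (hy : y ∈ Set.Icc (0 : ℝ) c.a) :
    HasDerivAt (c.g s n) (c.g s (n + 1) y) y :=
  TT_hasDeriv n s c.N c.A c.A' c.B c.B' y c.hN (c.h1 y hy) (c.h2 y hy)

lemma g_cont (n : ℕ) : ContinuousOn (fun q : ℂ × ℝ => c.g q.1 n q.2)
    (Set.univ ×ˢ Set.Icc (0 : ℝ) c.a) :=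
  TT_cont n c.N c.A c.A' c.B c.B' c.a c.hN c.h1 c.h2

lemma g_cont_y (s : ℂ) (n : ℕ) : ContinuousOn (fun y : ℝ => c.g s n y) (Set.Icc (0 : ℝ) c.a) :=
  (c.g_cont n).comp (f := fun y : ℝ => (s, y)) (by fun_prop) (fun y hy => ⟨trivial, hy⟩)

lemma g_diff (n : ℕ) (y : ℝ) : Differentiable ℂ (fun s => c.g s n y) :=
  TT_diff n c.N _ _ _ _

lemma g_bound (n : ℕ) (R : ℝ) : ∃ K : ℝ, 0 ≤ K ∧ ∀ s : ℂ, ‖s‖ ≤ R →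
    ∀ y ∈ Set.Icc (0 : ℝ) c.a, ‖c.g s n y‖ ≤ K := by
  have hcpt : IsCompact (Metric.closedBall (0 : ℂ) R ×ˢ Set.Icc (0 : ℝ) c.a) :=
    (isCompact_closedBall _ _).prod isCompact_Icc
  obtain ⟨K, hK⟩ := hcpt.exists_bound_of_continuousOn
    ((c.g_cont n).mono (Set.prod_mono (Set.subset_univ _) le_rfl))
  refine ⟨max K 0, le_max_right _ _, fun s hs y hy => le_max_of_le_left (hK (s, y) ⟨?_, hy⟩)⟩
  simpa using hs

lemma L_cont : ContinuousOn (fun y : ℝ => Real.log (c.N * (c.A + y * c.B) * (c.A' + y * c.B')))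
    (Set.Icc (0 : ℝ) c.a) := by
  refine ContinuousOn.log (by fun_prop) ?_
  intro y hy
  exact mul_ne_zero (mul_ne_zero c.hN.ne' (c.h1 y hy).ne') (c.h2 y hy).ne'

lemma II_diff : Differentiable ℂ c.II := by
  intro s₀
  set L : ℝ → ℝ := fun y => Real.log (c.N * (c.A + y * c.B) * (c.A' + y * c.B')) with hL
  obtain ⟨M, hM⟩ := isCompact_Icc.exists_bound_of_continuousOn c.L_cont
  obtain ⟨K, hK0, hK⟩ := c.g_bound 0 (‖s₀‖ + 1)
  have hg : ∀ s y, c.g s 0 y = Complex.exp (-s * (L y : ℂ)) := fun s y => TT_zero _ _ _ _ _ _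
  have h0 : (0 : ℝ) ≤ c.a := by positivity
  have hsub : Set.uIoc (0 : ℝ) c.a ⊆ Set.Icc 0 c.a := by
    rw [Set.uIoc_of_le h0]; exact Set.Ioc_subset_Icc_self
  have key := intervalIntegral.hasDerivAt_integral_of_dominated_loc_of_deriv_le (𝕜 := ℂ)
    (F := fun s y => c.g s 0 y) (F' := fun s y => -(L y : ℂ) * c.g s 0 y) (x₀ := s₀)
    (s := Metric.ball s₀ 1) (a := 0) (b := c.a) (bound := fun _ => M * K)
    (μ := MeasureTheory.volume) (Metric.ball_mem_nhds _ one_pos) ?_ ?_ ?_ ?_ ?_ ?_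
  · exact key.2.differentiableAt
  · refine Filter.Eventually.of_forall fun s => ?_
    exact ((c.g_cont_y s 0).mono hsub).aestronglyMeasurable measurableSet_uIoc
  · refine ContinuousOn.intervalIntegrable ?_
    rw [Set.uIcc_of_le h0]
    exact c.g_cont_y s₀ 0
  · refine ContinuousOn.aestronglyMeasurable ?_ measurableSet_uIoc
    refine ContinuousOn.mul ?_ ((c.g_cont_y s₀ 0).mono hsub)
    exact (Complex.continuous_ofReal.comp_continuousOn (c.L_cont.mono hsub)).neg
  · refine Filter.Eventually.of_forall fun y hy s hs => ?_
    rw [norm_mul]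
    refine mul_le_mul ?_ (hK s ?_ y (hsub hy)) (norm_nonneg _) ?_
    · rw [norm_neg, Complex.norm_real]; exact hM y (hsub hy)
    · have : dist s s₀ < 1 := hs
      have h2 := norm_sub_norm_le s s₀
      rw [dist_eq_norm] at this
      linarith
    · exact (norm_nonneg _).trans (hM y (hsub hy))
  · exact intervalIntegrable_const
  · refine Filter.Eventually.of_forall fun y hy s hs => ?_
    simp only [hg]
    have h := (((hasDerivAt_id s).neg).mul_const (L y : ℂ)).cexp
    refine h.congr_deriv ?_
    simp
    ring

lemma EE_diff (i : ℕ) : Differentiable ℂ (c.EE i) := by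
  unfold EE
  exact (c.g_diff _ _).sub (c.g_diff _ _)

lemma rm_diff (p m : ℕ) : Differentiable ℂ (c.rm p m) := by
  unfold rm tr trap
  refine Differentiable.sub (Differentiable.sub ?_ ?_) ?_
  · apply Differentiable.fun_sum
    intro n _
    have := c.g_diff 0
    refine Differentiable.div_const (Differentiable.add ?_ ?_) _
    · exact this _
    · exact this _
  · exact c.II_diff.const_mul _
  · apply Differentiable.fun_sum
    intro i _
    exact (c.EE_diff i).const_mul _

lemma rm_bound (p : ℕ) : ∃ C : ℝ, 0 ≤ C ∧ ∀ (s : ℂ) (K : ℝ),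
    (∀ y ∈ Set.Icc (0 : ℝ) c.a, ‖c.g s (2 * p + 2) y‖ ≤ K) → ∀ m : ℕ, 1 ≤ m →
    ‖c.rm p m s‖ ≤ C * K * (m : ℝ)⁻¹ ^ (2 * p + 1) := by
  obtain ⟨C, hC, h⟩ := euler_maclaurin p
  refine ⟨C * c.a, by positivity, fun s K hK m hm => ?_⟩
  exact h c.a (c.g s) (fun n y hy => c.g_hasDeriv s n y hy) K hK m hm

lemma g_zero (k n : ℕ) (hn : 2 * k < n) (y : ℝ) (hy : y ∈ Set.Icc (0 : ℝ) c.a) :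
    c.g (-(k : ℂ)) n y = 0 := by
  unfold g
  rw [TT_neg_nat k n _ _ _ _ _ c.hN (c.h1 y hy) (c.h2 y hy), coef_zero_of_lt k n hn]
  simp

lemma rm_zero (p k m : ℕ) (hk : k ≤ p) (hm : 1 ≤ m) : c.rm p m (-(k : ℂ)) = 0 := by
  obtain ⟨C, hC, h⟩ := c.rm_bound p
  have := h (-(k : ℂ)) 0 (fun y hy => by rw [c.g_zero k _ (by omega) y hy]; simp) m hm
  simpa using this

lemma RR_zero (p k : ℕ) (hk : k ≤ p) : c.RR p (-(k : ℂ)) = 0 := by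
  unfold RR
  simp [c.rm_zero p k _ hk (Nat.le_add_left 1 _)]

lemma norm_pw (m : ℕ) (s : ℂ) : ‖1 / ((m : ℂ) + 1) ^ (2 * s)‖ = ((m : ℝ) + 1) ^ (-2 * s.re) := by
  rw [norm_div, norm_one]
  have := Complex.norm_natCast_cpow_of_pos (Nat.succ_pos m) (2 * s)
  push_cast at this
  rw [this, one_div, ← Real.rpow_neg (by positivity)]
  simp

lemma term_bound (p : ℕ) (R σ : ℝ) (hσ : -(p : ℝ) < σ) : ∃ u : ℕ → ℝ, Summable u ∧
    ∀ (m : ℕ) (s : ℂ), ‖s‖ ≤ R → σ ≤ s.re →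
      ‖1 / ((m : ℂ) + 1) ^ (2 * s) * c.rm p (m + 1) s‖ ≤ u m := by
  obtain ⟨K, hK0, hK⟩ := c.g_bound (2 * p + 2) R
  obtain ⟨C, hC, h⟩ := c.rm_bound p
  refine ⟨fun m => C * K * ((m : ℝ) + 1) ^ (-(2 * σ + 2 * p + 1)), ?_, ?_⟩
  · apply Summable.mul_left
    have h1 := (Real.summable_nat_rpow (p := -(2 * σ + 2 * p + 1))).2 (by linarith)
    have := (summable_nat_add_iff 1).2 h1
    push_cast at this
    exact this
  · intro m s hs hre
    have hb := h s K (hK s hs) (m + 1) (by omega)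
    have hm1 : (1 : ℝ) ≤ (m : ℝ) + 1 := by have : (0 : ℝ) ≤ m := by positivity
                                           linarith
    rw [norm_mul, norm_pw]
    calc _ ≤ ((m : ℝ) + 1) ^ (-2 * σ) * (C * K * ((m + 1 : ℕ) : ℝ)⁻¹ ^ (2 * p + 1)) := by
          refine mul_le_mul ?_ hb (norm_nonneg _) (by positivity)
          exact Real.rpow_le_rpow_of_exponent_le hm1 (by linarith)
      _ = _ := by
          push_cast
          rw [← Real.rpow_natCast, Real.inv_rpow (by positivity), ← Real.rpow_neg (by positivity)]
          rw [mul_left_comm, ← Real.rpow_add (by positivity)]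
          congr 2
          push_cast
          ring

lemma RR_diff (p : ℕ) : DifferentiableOn ℂ (c.RR p) {s | -(p : ℝ) < s.re} := by
  intro s₀ hs₀
  simp only [Set.mem_setOf_eq] at hs₀
  set σ : ℝ := (s₀.re - p) / 2 with hσ
  obtain ⟨u, hu, hb⟩ := c.term_bound p (‖s₀‖ + 1) σ (by linarith)
  have hopen : IsOpen (Metric.ball s₀ 1 ∩ {s : ℂ | σ < s.re}) :=
    Metric.isOpen_ball.inter (isOpen_lt continuous_const Complex.continuous_re)
  have hd : DifferentiableOn ℂ (c.RR p) (Metric.ball s₀ 1 ∩ {s : ℂ | σ < s.re}) := by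
    unfold RR
    refine Complex.differentiableOn_tsum_of_summable_norm (u := u) hu ?_ hopen ?_
    · intro m
      refine DifferentiableOn.mul ?_ (c.rm_diff p (m + 1)).differentiableOn
      have hne : ((m : ℂ) + 1) ≠ 0 := by exact_mod_cast Nat.succ_ne_zero m
      refine DifferentiableOn.div (by fun_prop) ?_ (fun s _ => by simp [Complex.cpow_eq_zero_iff, hne])
      exact (Differentiable.const_cpow (by fun_prop) (Or.inl hne)).differentiableOn
    · rintro m s ⟨hs, hre⟩
      refine hb m s ?_ (le_of_lt hre)
      have : dist s s₀ < 1 := hs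
      have h2 := norm_sub_norm_le s s₀
      rw [dist_eq_norm] at this
      linarith
  refine (hd.differentiableAt (hopen.mem_nhds ⟨Metric.mem_ball_self one_pos, ?_⟩)).differentiableWithinAt
  simp only [Set.mem_setOf_eq]; linarith

/-- closed form of the cone zeta function -/
def WW (p : ℕ) (s : ℂ) : ℂ := riemannZeta (2 * s - 1) * c.II s +
  ∑ i ∈ Finset.range (p + 1), (bet (2 * i + 2) : ℂ) * riemannZeta (2 * s + 2 * i + 1) * c.EE i s +
  c.RR p s

lemma hasSum_zeta (s : ℂ) (hs : 1 < s.re) :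
    HasSum (fun m : ℕ => 1 / ((m : ℂ) + 1) ^ s) (riemannZeta s) := by
  rw [zeta_eq_tsum_one_div_nat_add_one_cpow hs]
  apply Summable.hasSum
  have := (summable_nat_add_iff 1).2 (Complex.summable_one_div_nat_cpow.2 hs)
  push_cast at this
  exact this

lemma hasSum_tr (p : ℕ) (s : ℂ) (hs : 1 < s.re) :
    HasSum (fun m : ℕ => 1 / ((m : ℂ) + 1) ^ (2 * s) * c.tr (m + 1) s) (c.WW p s) := by
  have hp : (0 : ℝ) ≤ p := by positivity
  have h1 := (hasSum_zeta (2 * s - 1) (by simp; linarith)).mul_right (c.II s)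
  have h2 : ∀ i ∈ Finset.range (p + 1), HasSum
      (fun m : ℕ => (bet (2 * i + 2) : ℂ) * (1 / ((m : ℂ) + 1) ^ (2 * s + 2 * i + 1)) * c.EE i s)
      ((bet (2 * i + 2) : ℂ) * riemannZeta (2 * s + 2 * i + 1) * c.EE i s) := by
    intro i _
    refine ((hasSum_zeta (2 * s + 2 * i + 1) ?_).mul_left _).mul_right _
    simp
    positivity
  have h3 : HasSum (fun m : ℕ => 1 / ((m : ℂ) + 1) ^ (2 * s) * c.rm p (m + 1) s) (c.RR p s) := by
    apply Summable.hasSum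
    obtain ⟨u, hu, hb⟩ := c.term_bound p ‖s‖ s.re (by linarith)
    exact Summable.of_norm_bounded hu (fun m => hb m s le_rfl le_rfl)
  refine ((h1.add (hasSum_sum h2)).add h3).congr_fun ?_
  intro m
  have hne : ((m : ℂ) + 1) ≠ 0 := by exact_mod_cast Nat.succ_ne_zero m
  have e1 : 1 / ((m : ℂ) + 1) ^ (2 * s - 1) = 1 / ((m : ℂ) + 1) ^ (2 * s) * ((m : ℂ) + 1) := by
    rw [Complex.cpow_sub _ _ hne, Complex.cpow_one]
    field_simp
  have e2 : ∀ i : ℕ, 1 / ((m : ℂ) + 1) ^ (2 * s + 2 * i + 1) =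
      1 / ((m : ℂ) + 1) ^ (2 * s) * ((m : ℂ) + 1)⁻¹ ^ (2 * i + 1) := by
    intro i
    rw [show 2 * s + 2 * (i : ℂ) + 1 = 2 * s + ((2 * i + 1 : ℕ) : ℂ) by push_cast; ring,
      Complex.cpow_add _ _ hne, Complex.cpow_natCast, inv_pow]
    field_simp
  rw [e1]
  simp only [e2]
  unfold rm
  rw [mul_sub, mul_sub, Finset.mul_sum]
  push_cast
  rw [Finset.sum_congr rfl (fun x _ => show (bet (2 * x + 2) : ℂ) *
    (1 / ((m : ℂ) + 1) ^ (2 * s) * ((m : ℂ) + 1)⁻¹ ^ (2 * x + 1)) * c.EE x s =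
    1 / ((m : ℂ) + 1) ^ (2 * s) * ((bet (2 * x + 2) : ℂ) * ((m : ℂ) + 1)⁻¹ ^ (2 * x + 1) * c.EE x s)
    by ring)]
  ring

end LCone

/-! ### Part 4: lattice sums -/

/-- half-plane weight -/
def tht (d : ℤ) : ℝ := if 0 < d then 1 else if d = 0 then 1 / 2 else 0

lemma tht_pos {d : ℤ} (h : 0 < d) : tht d = 1 := by simp [tht, h]
lemma tht_zero : tht 0 = 1 / 2 := by simp [tht]
lemma tht_neg {d : ℤ} (h : d < 0) : tht d = 0 := by
  simp [tht, not_lt.2 h.le, h.ne]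

lemma tht_step (d : ℤ) : tht d - tht (d - 1) = (if d = 0 then 1 / 2 else 0) + (if d = 1 then 1 / 2 else 0) := by
  rcases lt_trichotomy d 0 with h | h | h
  · rw [tht_neg h, tht_neg (by omega), if_neg (by omega), if_neg (by omega)]; simp
  · subst h; rw [tht_zero, tht_neg (by omega)]; simp
  · rcases eq_or_ne d 1 with h1 | h1
    · subst h1; rw [tht_pos (by omega)]; simp [tht_zero]; norm_num
    · rw [tht_pos h, tht_pos (by omega), if_neg (by omega), if_neg h1]; simp

lemma trap_hasSum (M : ℕ) (h : ℕ → ℂ) :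
    HasSum (fun n : ℕ => ((tht n - tht ((n : ℤ) - M) : ℝ) : ℂ) * h n) (trap M h) := by
  induction M with
  | zero => simp [trap, hasSum_zero]
  | succ M ih =>
    have h1 := (hasSum_ite_eq M (h M / 2)).add (hasSum_ite_eq (M + 1) (h (M + 1) / 2))
    have h2 := ih.add h1
    have e : trap (M + 1) h = trap M h + (h M / 2 + h (M + 1) / 2) := by
      unfold trap
      rw [Finset.sum_range_succ]
      ring
    rw [e]
    refine h2.congr_fun fun n => ?_
    have := tht_step ((n : ℤ) - M)
    rw [show tht n - tht ((n : ℤ) - (M + 1 : ℕ)) = (tht n - tht ((n : ℤ) - M)) +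
      (tht ((n : ℤ) - M) - tht ((n : ℤ) - M - 1)) by
        push_cast; rw [sub_sub (n : ℤ)]; ring, this]
    rw [Complex.ofReal_add, add_mul]
    congr 1
    rcases eq_or_ne n M with h3 | h3
    · subst h3; simp; ring
    · rcases eq_or_ne n (M + 1) with h4 | h4
      · subst h4; simp; ring
      · rw [if_neg (by omega), if_neg (by omega), if_neg h3, if_neg h4]; simp

lemma tht_hasSum (M : ℕ) : HasSum (fun n : ℕ => tht n - tht ((n : ℤ) - M)) (M : ℝ) := by
  have h := trap_hasSum M (fun _ => 1)
  have e : trap M (fun _ => 1) = ((M : ℝ) : ℂ) := by simp [trap]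
  rw [e] at h
  simp only [mul_one] at h
  exact Complex.hasSum_ofReal.1 h

lemma tht_diff_nonneg (n M : ℕ) : 0 ≤ tht n - tht ((n : ℤ) - M) := by
  have h : 0 ≤ tht n ∧ tht ((n : ℤ) - M) ≤ tht n := by
    unfold tht
    constructor
    · split_ifs <;> norm_num
    · split_ifs <;> first | omega | norm_num
  linarith [h.2]

lemma tht_diff_ne (n M : ℕ) (h : tht n - tht ((n : ℤ) - M) ≠ 0) : n ≤ M := by
  by_contra hn
  apply h
  rw [tht_pos (by omega), tht_pos (by omega)]
  simp

/-- the weight of a cone inside the positive quadrant -/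
def cw (ω ω' : ℝ) (u x : ℤ × ℤ) (M : ℤ × ℤ) : ℝ :=
  if 0 < M.1 * ω + M.2 ∧ 0 < M.1 * ω' + M.2 then
    tht (u.2 * M.1 - u.1 * M.2) - tht (x.2 * M.1 - x.1 * M.2) else 0

lemma wt_eq (ω ω' : ℝ) (hω : 1 < ω) (hω' : ω' < 0) (p q : ℤ) (hp : 0 < p) (hq : 0 < p * ω' + q)
    (M : ℤ × ℤ) : wt (0, 1) ((p : ℝ), (q : ℝ)) M = cw ω ω' (0, 1) (p, q) M := by
  obtain ⟨m, n⟩ := M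
  have hp' : (0 : ℝ) < p := by exact_mod_cast hp
  have hq' : (0 : ℝ) < q := by nlinarith
  unfold wt cw
  simp only [Prod.mk.injEq, Prod.smul_mk, smul_eq_mul, Prod.mk_add_mk, mul_zero, mul_one, zero_add,
    one_mul, zero_mul, sub_zero]
  have hm1 : (0 : ℝ) < m ↔ 0 < m := by exact_mod_cast Iff.rfl
  by_cases c1 : ∃ x₁ x₂ : ℝ, 0 < x₁ ∧ 0 < x₂ ∧ (m : ℝ) = x₂ * p ∧ (n : ℝ) = x₁ + x₂ * q
  · rw [if_pos c1]
    obtain ⟨x, y, hx, hy, e1, e2⟩ := c1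
    have g1 : 0 < (m : ℝ) * ω + n := by
      rw [e1, e2]; positivity
    have g2 : 0 < (m : ℝ) * ω' + n := by
      rw [e1, e2]; nlinarith
    rw [if_pos ⟨g1, g2⟩, tht_pos (d := m), tht_neg]
    · simp
    · have : (q : ℝ) * m - p * n < 0 := by rw [e1, e2]; nlinarith
      exact_mod_cast this
    · have : (0 : ℝ) < m := by rw [e1]; positivity
      exact_mod_cast this
  rw [if_neg c1]
  by_cases c2 : ∃ t : ℝ, 0 < t ∧ ((m : ℝ) = 0 ∧ (n : ℝ) = t ∨ (m : ℝ) = t * p ∧ (n : ℝ) = t * q)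
  · rw [if_pos c2]
    obtain ⟨t, ht, ⟨e1, e2⟩ | ⟨e1, e2⟩⟩ := c2
    · have hm : m = 0 := by exact_mod_cast e1
      have hn : 0 < n := by rw [← e2] at ht; exact_mod_cast ht
      subst hm
      rw [if_pos (by simp [e2, ht]), tht_zero, tht_neg]
      · simp
      · simp; positivity
    · have g1 : 0 < (m : ℝ) * ω + n := by
        rw [e1, e2]; positivity
      have g2 : 0 < (m : ℝ) * ω' + n := by
        rw [e1, e2]; nlinarith
      have hm : (0 : ℝ) < m := by rw [e1]; positivity
      have hd : q * m - p * n = 0 := by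
        have : (q : ℝ) * m - p * n = 0 := by rw [e1, e2]; ring
        exact_mod_cast this
      rw [if_pos ⟨g1, g2⟩, hd, tht_zero, tht_pos (hm1.1 hm)]
      norm_num
  rw [if_neg c2]
  split_ifs with hM
  · obtain ⟨g1, g2⟩ := hM
    rcases lt_trichotomy m 0 with h | h | h
    · have hmr : (m : ℝ) < 0 := by exact_mod_cast h
      have hnr : 0 < (n : ℝ) := by nlinarith
      rw [tht_neg h, tht_neg]
      · simp
      · have : (q : ℝ) * m - p * n < 0 := by nlinarith [mul_pos hp' hnr, mul_pos hq' (neg_pos.2 hmr)]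
        exact_mod_cast this
    · exfalso
      subst h
      apply c2
      refine ⟨n, ?_, Or.inl ⟨by simp, rfl⟩⟩
      simpa using g1
    · have hmr : (0 : ℝ) < m := by exact_mod_cast h
      rw [tht_pos h, tht_pos]
      · simp
      · have : (0 : ℝ) < (q : ℝ) * m - p * n := by
          by_contra hneg
          push Not at hneg
          rcases hneg.lt_or_eq with h1 | h1
          · apply c1
            refine ⟨n - m / p * q, m / p, ?_, by positivity, ?_, by ring⟩
            · have : n - m / p * q = (p * n - q * m : ℝ) / p := by field_simp
              rw [this]
              apply div_pos _ hp'
              linarith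
            · field_simp
          · apply c2
            refine ⟨m / p, by positivity, Or.inr ⟨by field_simp, ?_⟩⟩
            field_simp
            linarith
        exact_mod_cast this
  · rfl

lemma exp_scale (s : ℂ) (N A A' B B' : ℝ) (m n : ℕ) (hN : 0 < N)
    (h1 : 0 < A + ((n : ℝ) / ((m + 1 : ℕ) : ℝ)) * B) (h2 : 0 < A' + ((n : ℝ) / ((m + 1 : ℕ) : ℝ)) * B') :
    Complex.exp (-s * Complex.log ((N * (((m : ℝ) + 1) * A + n * B) * (((m : ℝ) + 1) * A' + n * B') : ℝ) : ℂ)) =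
      1 / ((m : ℂ) + 1) ^ (2 * s) *
        TT 0 s N (A + ((n : ℝ) / ((m + 1 : ℕ) : ℝ)) * B) (A' + ((n : ℝ) / ((m + 1 : ℕ) : ℝ)) * B') B B' := by
  have hne : ((m : ℂ) + 1) ≠ 0 := by exact_mod_cast Nat.succ_ne_zero m
  have hm : (0 : ℝ) < (m : ℝ) + 1 := by positivity
  rw [TT_zero, Complex.cpow_def_of_ne_zero hne, one_div, ← Complex.exp_neg, ← Complex.exp_add]
  congr 1
  set X := A + ((n : ℝ) / ((m + 1 : ℕ) : ℝ)) * B with hX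
  set X' := A' + ((n : ℝ) / ((m + 1 : ℕ) : ℝ)) * B' with hX'
  have e1 : ((m : ℝ) + 1) * A + n * B = (m + 1) * X := by
    rw [hX]; push_cast; field_simp
  have e2 : ((m : ℝ) + 1) * A' + n * B' = (m + 1) * X' := by
    rw [hX']; push_cast; field_simp
  rw [e1, e2, ← Complex.ofReal_log (by positivity), show N * (((m : ℝ) + 1) * X) * (((m : ℝ) + 1) * X') =
    ((m : ℝ) + 1) * ((m : ℝ) + 1) * (N * X * X') by ring, Real.log_mul (by positivity) (by positivity),
    Real.log_mul (by positivity) (by positivity)]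
  have : Complex.log ((m : ℂ) + 1) = (Real.log ((m : ℝ) + 1) : ℂ) := by
    rw [Complex.ofReal_log (by positivity)]; push_cast; rfl
  rw [this]
  push_cast
  ring

lemma LCone.hasSum_lattice (c : LCone) (p : ℕ) (ω ω' : ℝ) (u v : ℤ × ℤ)
    (hdet : u.2 * v.1 - u.1 * v.2 = 1)
    (hA : c.A = u.1 * ω + u.2) (hA' : c.A' = u.1 * ω' + u.2)
    (hB : c.B = v.1 * ω + v.2) (hB' : c.B' = v.1 * ω' + v.2)
    (hBp : 0 < c.B) (hBn : c.B' < 0) (s : ℂ) (hs : 1 < s.re) :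
    HasSum (fun M : ℤ × ℤ => (cw ω ω' u (u.1 + c.a * v.1, u.2 + c.a * v.2) M : ℂ) *
      Complex.exp (-s * Complex.log ((c.N * (M.1 * ω + M.2) * (M.1 * ω' + M.2) : ℝ) : ℂ))) (c.WW p s) := by
  have hAp : 0 < c.A := by simpa using c.h1 0 ⟨le_rfl, by positivity⟩
  have hAp' : 0 < c.A' := by simpa using c.h2 0 ⟨le_rfl, by positivity⟩
  set φ : ℕ × ℕ → ℤ × ℤ := fun q => ((q.1 + 1) * u.1 + q.2 * v.1, (q.1 + 1) * u.2 + q.2 * v.2) with hφ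
  have hd1 : ∀ q, u.2 * (φ q).1 - u.1 * (φ q).2 = q.2 := by
    intro q; simp only [hφ]; linear_combination (q.2 : ℤ) * hdet
  have hd2 : ∀ q, (φ q).2 * v.1 - (φ q).1 * v.2 = q.1 + 1 := by
    intro q; simp only [hφ]; linear_combination ((q.1 : ℤ) + 1) * hdet
  have hinj : Function.Injective φ := by
    intro q q' h
    have h1 := hd1 q
    have h2 := hd2 q
    rw [h, hd1] at h1
    rw [h, hd2] at h2
    ext <;> omega
  have hcomb : ∀ M : ℤ × ℤ, M.1 = (M.2 * v.1 - M.1 * v.2) * u.1 + (u.2 * M.1 - u.1 * M.2) * v.1 ∧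
      M.2 = (M.2 * v.1 - M.1 * v.2) * u.2 + (u.2 * M.1 - u.1 * M.2) * v.2 := by
    intro M
    constructor
    · linear_combination (-M.1) * hdet
    · linear_combination (-M.2) * hdet
  rw [← hinj.hasSum_iff]
  · set f : ℕ × ℕ → ℂ := fun q => ((tht q.2 - tht ((q.2 : ℤ) - (c.a * (q.1 + 1) : ℕ)) : ℝ) : ℂ) *
      (1 / ((q.1 : ℂ) + 1) ^ (2 * s) * c.g s 0 ((q.2 : ℝ) / ((q.1 + 1 : ℕ) : ℝ))) with hf
    have hyI : ∀ m n : ℕ, n ≤ c.a * (m + 1) → (n : ℝ) / ((m + 1 : ℕ) : ℝ) ∈ Set.Icc (0 : ℝ) c.a := by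
      intro m n hn
      refine ⟨by positivity, ?_⟩
      rw [div_le_iff₀ (by positivity)]
      exact_mod_cast hn
    have hfe : ((fun M : ℤ × ℤ => (cw ω ω' u (u.1 + c.a * v.1, u.2 + c.a * v.2) M : ℂ) *
      Complex.exp (-s * Complex.log ((c.N * (M.1 * ω + M.2) * (M.1 * ω' + M.2) : ℝ) : ℂ))) ∘ φ) = f := by
      funext q
      obtain ⟨m, n⟩ := q
      have hdx : (u.2 + c.a * v.2) * (φ (m, n)).1 - (u.1 + c.a * v.1) * (φ (m, n)).2 =
          (n : ℤ) - (c.a * (m + 1) : ℕ) := by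
        simp only [hφ]; push_cast; linear_combination ((n : ℤ) - c.a * (m + 1)) * hdet
      have e1 : ((φ (m, n)).1 : ℝ) * ω + (φ (m, n)).2 = ((m : ℝ) + 1) * c.A + n * c.B := by
        simp only [hφ]; rw [hA, hB]; push_cast; ring
      have e2 : ((φ (m, n)).1 : ℝ) * ω' + (φ (m, n)).2 = ((m : ℝ) + 1) * c.A' + n * c.B' := by
        simp only [hφ]; rw [hA', hB']; push_cast; ring
      simp only [Function.comp, hf]
      rw [e1, e2]
      unfold cw
      rw [e1, e2, hd1 (m, n), hdx]
      by_cases h0 : tht n - tht ((n : ℤ) - (c.a * (m + 1) : ℕ)) = 0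
      · simp only [h0, ite_self]; simp
      · have hn := hyI m n (tht_diff_ne _ _ h0)
        have p1 := c.h1 _ hn
        have p2 := c.h2 _ hn
        rw [exp_scale s c.N c.A c.A' c.B c.B' m n c.hN p1 p2, if_pos]
        · rfl
        · have hm : (0 : ℝ) < ((m + 1 : ℕ) : ℝ) := by positivity
          have k1 := mul_pos hm p1
          have k2 := mul_pos hm p2
          rw [mul_add, ← mul_assoc, mul_div_cancel₀ _ hm.ne'] at k1 k2
          push_cast at k1 k2
          exact ⟨k1, k2⟩
    rw [hfe]
    have hfib : ∀ m : ℕ, HasSum (fun n => f (m, n)) (1 / ((m : ℂ) + 1) ^ (2 * s) * c.tr (m + 1) s) := by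
      intro m
      have := (trap_hasSum (c.a * (m + 1)) (fun n => c.g s 0 ((n : ℝ) / ((m + 1 : ℕ) : ℝ)))).mul_left
        (1 / ((m : ℂ) + 1) ^ (2 * s))
      refine this.congr_fun fun n => ?_
      simp only [hf]
      ring
    have hsum : Summable f := by
      obtain ⟨K, hK0, hK⟩ := c.g_bound 0 ‖s‖
      set F : ℕ × ℕ → ℝ := fun q => (tht q.2 - tht ((q.2 : ℤ) - (c.a * (q.1 + 1) : ℕ))) *
        (((q.1 : ℝ) + 1) ^ (-2 * s.re) * K) with hF
      have hFfib : ∀ m, HasSum (fun n => F (m, n)) (((c.a * (m + 1) : ℕ) : ℝ) * (((m : ℝ) + 1) ^ (-2 * s.re) * K)) :=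
        fun m => (tht_hasSum (c.a * (m + 1))).mul_right _
      have hFs : Summable F := by
        rw [summable_prod_of_nonneg]
        · refine ⟨fun m => (hFfib m).summable, ?_⟩
          simp only [(hFfib _).tsum_eq]
          have h1 := (Real.summable_nat_rpow (p := -2 * s.re + 1)).2 (by linarith)
          have h2 := ((summable_nat_add_iff 1).2 h1).mul_left (c.a * K)
          refine h2.congr fun m => ?_
          push_cast
          rw [Real.rpow_add (by positivity), Real.rpow_one]
          ring
        · intro q
          exact mul_nonneg (tht_diff_nonneg _ _) (by positivity)
      refine Summable.of_norm_bounded hFs ?_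
      rintro ⟨m, n⟩
      simp only [hf, hF]
      rw [norm_mul, norm_mul, LCone.norm_pw, Complex.norm_real, Real.norm_of_nonneg (tht_diff_nonneg _ _)]
      by_cases h0 : tht n - tht ((n : ℤ) - (c.a * (m + 1) : ℕ)) = 0
      · rw [h0]; simp
      · have hn := hyI m n (tht_diff_ne _ _ h0)
        gcongr
        · exact tht_diff_nonneg _ _
        · exact hK s le_rfl _ hn
    have := hsum.hasSum.prod_fiberwise hfib
    rw [← this.unique (c.hasSum_tr p s hs)]
    exact hsum.hasSum
  · intro M hM
    suffices h : cw ω ω' u (u.1 + c.a * v.1, u.2 + c.a * v.2) M = 0 by simp [h]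
    unfold cw
    split_ifs with hpos
    · obtain ⟨g1, g2⟩ := hpos
      obtain ⟨k1, k2⟩ := hcomb M
      set m0 := M.2 * v.1 - M.1 * v.2 with hm0
      set n0 := u.2 * M.1 - u.1 * M.2 with hn0
      have e1 : (M.1 : ℝ) * ω + M.2 = m0 * c.A + n0 * c.B := by
        have k1' : (M.1 : ℝ) = m0 * u.1 + n0 * v.1 := by exact_mod_cast k1
        have k2' : (M.2 : ℝ) = m0 * u.2 + n0 * v.2 := by exact_mod_cast k2
        rw [hA, hB]; linear_combination ω * k1' + k2'
      have e2 : (M.1 : ℝ) * ω' + M.2 = m0 * c.A' + n0 * c.B' := by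
        have k1' : (M.1 : ℝ) = m0 * u.1 + n0 * v.1 := by exact_mod_cast k1
        have k2' : (M.2 : ℝ) = m0 * u.2 + n0 * v.2 := by exact_mod_cast k2
        rw [hA', hB']; linear_combination ω' * k1' + k2'
      rw [e1] at g1
      rw [e2] at g2
      have hm0p : 0 < m0 := by
        by_contra hneg
        push Not at hneg
        have hr : (m0 : ℝ) ≤ 0 := by exact_mod_cast hneg
        have hnp : (0 : ℝ) < n0 := by nlinarith
        nlinarith
      have hn0n : n0 < 0 := by
        by_contra hneg
        push Not at hneg
        apply hM
        refine ⟨((m0 - 1).toNat, n0.toNat), ?_⟩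
        simp only [hφ]
        have t1 : ((m0 - 1).toNat : ℤ) = m0 - 1 := Int.toNat_of_nonneg (by omega)
        have t2 : (n0.toNat : ℤ) = n0 := Int.toNat_of_nonneg hneg
        rw [t1, t2]
        ext
        · rw [k1]; ring
        · rw [k2]; ring
      have hdx : (u.2 + c.a * v.2) * M.1 - (u.1 + c.a * v.1) * M.2 = n0 - c.a * m0 := by
        rw [hm0, hn0]; ring
      simp only
      rw [hdx, tht_neg hn0n, tht_neg]
      · simp
      · have : 0 ≤ (c.a : ℤ) * m0 := by positivity
        omega
    · rfl

/-! ### Part 5: analytic continuation and the value at `-k` -/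

/-- real data attached to a periodic continued fraction with even period twice h -/
structure CFD where
  N : ℝ
  h : ℕ
  b : ℕ → ℕ
  x : ℕ → ℝ
  x' : ℕ → ℝ
  e : ℝ
  e' : ℝ
  hN : 0 < N
  hrec : ∀ i, x (i + 2) = b i * x (i + 1) + x i
  hrec' : ∀ i, x' (i + 2) = b i * x' (i + 1) + x' i
  hpos : ∀ i, 0 < x i
  hpos' : ∀ j, 0 < x' (2 * j + 1)
  hneg' : ∀ j, x' (2 * j) < 0
  hee : e * e' = 1
  hs0 : x (2 * h) = e * x 0
  hs0' : x' (2 * h) = e' * x' 0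
  hs1 : x (2 * h + 1) = e * x 1
  hs1' : x' (2 * h + 1) = e' * x' 1

namespace CFD

variable (D : CFD)

def cone (j : ℕ) : LCone where
  N := D.N
  A := D.x (2 * j + 1)
  A' := D.x' (2 * j + 1)
  B := D.x (2 * j + 2)
  B' := D.x' (2 * j + 2)
  a := D.b (2 * j + 1)
  hN := D.hN
  h1 := by
    intro y hy
    have h1 := D.hpos (2 * j + 1)
    have h2 := D.hpos (2 * j + 2)
    have := mul_nonneg hy.1 h2.le
    linarith
  h2 := by
    intro y hy
    have h1 := D.hpos' (j + 1)
    have h2 := D.hneg' (j + 1)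
    have h3 := D.hrec' (2 * j + 1)
    rw [show 2 * (j + 1) + 1 = 2 * j + 1 + 2 by ring, h3] at h1
    rw [show 2 * (j + 1) = 2 * j + 1 + 1 by ring] at h2
    have := mul_nonneg (sub_nonneg.2 hy.2) (neg_nonneg.2 h2.le)
    have e : D.x' (2 * j + 2) = D.x' (2 * j + 1 + 1) := rfl
    rw [e]
    nlinarith

def JJ (k j : ℕ) (s : ℂ) : ℂ := ∫ τ in (0 : ℝ)..D.b (2 * j),
  TT (2 * k) s D.N (D.x (2 * j + 1)) (D.x' (2 * j + 1))
    (D.x (2 * j) + τ * D.x (2 * j + 1)) (D.x' (2 * j) + τ * D.x' (2 * j + 1))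

lemma JJ_cont (k j : ℕ) : Continuous (D.JJ k j) := by
  unfold JJ
  apply intervalIntegral.continuous_parametric_intervalIntegral_of_continuous'
  exact TT_trans_cont _ _ _ _ _ _

lemma sum_EE (k : ℕ) (s : ℂ) : ∑ j ∈ Finset.range D.h, (D.cone j).EE k s =
    (2 * k + 1) * (2 * s + 2 * k) * ∑ j ∈ Finset.range D.h, D.JJ k j s := by
  set G : ℕ → ℂ := fun j => TT (2 * k + 1) s D.N (D.x (2 * j + 1)) (D.x' (2 * j + 1))
    (D.x (2 * j)) (D.x' (2 * j)) with hG
  have h1 : ∀ j, (D.cone j).EE k s = G (j + 1) - TT (2 * k + 1) s D.N (D.x (2 * j + 1)) (D.x' (2 * j + 1))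
      (D.x (2 * j + 2)) (D.x' (2 * j + 2)) := by
    intro j
    unfold LCone.EE LCone.g
    simp only [cone, hG]
    have e1 := D.hrec (2 * j + 1)
    have e2 := D.hrec' (2 * j + 1)
    rw [show 2 * (j + 1) + 1 = 2 * j + 1 + 2 by ring, show 2 * (j + 1) = 2 * j + 1 + 1 by ring, e1, e2]
    rw [show 2 * j + 2 = 2 * j + 1 + 1 by ring]
    simp only [zero_mul, add_zero]
    rw [add_comm (D.x (2 * j + 1)), add_comm (D.x' (2 * j + 1))]
  have h2 : G D.h = G 0 := by
    simp only [hG]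
    rw [D.hs0, D.hs0', D.hs1, D.hs1', TT_scale _ _ _ _ _ _ _ _ _ D.hee]
  have h3 : ∑ j ∈ Finset.range D.h, G (j + 1) = ∑ j ∈ Finset.range D.h, G j := by
    have := Finset.sum_range_succ G D.h
    rw [Finset.sum_range_succ', h2] at this
    exact add_right_cancel this
  simp only [h1]
  rw [Finset.sum_sub_distrib, h3, ← Finset.sum_sub_distrib, Finset.mul_sum]
  apply Finset.sum_congr rfl
  intro j _
  have e1 := D.hrec (2 * j)
  have e2 := D.hrec' (2 * j)
  have := TT_trans_sub (2 * k) s D.N (D.x (2 * j + 1)) (D.x' (2 * j + 1)) (D.x (2 * j)) (D.x' (2 * j))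
    (D.b (2 * j)) (D.hpos _).ne' (D.hpos' _).ne'
  simp only [hG]
  rw [e1, e2, add_comm (_ * D.x (2 * j + 1)), add_comm (_ * D.x' (2 * j + 1)), ← neg_sub, this]
  unfold JJ
  push_cast
  ring

/-- regular part -/
def REG (k j : ℕ) (s : ℂ) : ℂ := riemannZeta (2 * s - 1) * (D.cone j).II s +
  ∑ i ∈ Finset.range k, (bet (2 * i + 2) : ℂ) * riemannZeta (2 * s + 2 * i + 1) * (D.cone j).EE i s +
  ((bet (2 * (k + 1) + 2) : ℂ) * riemannZeta (2 * s + 2 * (k + 1 : ℕ) + 1) * (D.cone j).EE (k + 1) s +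
  (D.cone j).RR (k + 1) s)

lemma sum_WW (k : ℕ) (s : ℂ) : ∑ j ∈ Finset.range D.h, (D.cone j).WW (k + 1) s =
    ∑ j ∈ Finset.range D.h, D.REG k j s + (bet (2 * k + 2) : ℂ) * (2 * k + 1) *
      ((2 * s + 2 * k) * riemannZeta (2 * s + 2 * k + 1)) * ∑ j ∈ Finset.range D.h, D.JJ k j s := by
  have : ∀ j, (D.cone j).WW (k + 1) s = D.REG k j s +
      (bet (2 * k + 2) : ℂ) * riemannZeta (2 * s + 2 * k + 1) * (D.cone j).EE k s := by
    intro j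
    unfold LCone.WW REG
    rw [Finset.sum_range_succ, Finset.sum_range_succ]
    push_cast
    ring
  simp only [this]
  rw [Finset.sum_add_distrib, ← Finset.mul_sum, D.sum_EE]
  ring

lemma zeta_comp_cont (c s₀ : ℂ) (h : 2 * s₀ + c ≠ 1) :
    ContinuousAt (fun s : ℂ => riemannZeta (2 * s + c)) s₀ := by
  have h1 := (differentiableAt_riemannZeta h).continuousAt
  exact ContinuousAt.comp (f := fun s : ℂ => 2 * s + c) h1 (by fun_prop)

lemma nat_ne (a b : ℕ) (h : a ≠ b) : (a : ℂ) ≠ b := by exact_mod_cast h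

lemma REG_cont (k j : ℕ) : ContinuousAt (D.REG k j) (-(k : ℂ)) := by
  unfold REG
  have hz : ∀ c : ℂ, 2 * (-(k : ℂ)) + c ≠ 1 → ContinuousAt (fun s : ℂ => riemannZeta (2 * s + c)) (-(k : ℂ)) :=
    fun c hc => zeta_comp_cont c _ hc
  refine ContinuousAt.add (ContinuousAt.add ?_ ?_) (ContinuousAt.add ?_ ?_)
  · refine ContinuousAt.mul ?_ (D.cone j).II_diff.continuous.continuousAt
    refine hz (-1) ?_
    intro h
    apply nat_ne (2 * k + 2) 0 (by omega)
    push_cast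
    linear_combination -h
  · refine tendsto_finsetSum _ fun i hi => ?_
    rw [Finset.mem_range] at hi
    refine ContinuousAt.mul (ContinuousAt.mul continuousAt_const ?_)
      ((D.cone j).EE_diff i).continuous.continuousAt
    simp only [add_assoc]
    refine hz _ ?_
    intro h
    apply nat_ne (2 * i) (2 * k) (by omega)
    push_cast
    linear_combination h
  · refine ContinuousAt.mul (ContinuousAt.mul continuousAt_const ?_)
      ((D.cone j).EE_diff _).continuous.continuousAt
    simp only [add_assoc]
    refine hz _ ?_
    intro h
    apply nat_ne 2 0 (by omega)
    push_cast at h ⊢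
    linear_combination h
  · refine ((D.cone j).RR_diff (k + 1)).continuousOn.continuousAt (IsOpen.mem_nhds ?_ ?_)
    · exact isOpen_lt continuous_const Complex.continuous_re
    · simp

lemma REG_val (k j : ℕ) : D.REG k j (-(k : ℂ)) = riemannZeta (2 * (-(k : ℂ)) - 1) * (D.cone j).II (-(k : ℂ)) +
    ∑ i ∈ Finset.range k, (bet (2 * i + 2) : ℂ) * riemannZeta (2 * (-(k : ℂ)) + 2 * i + 1) *
      (D.cone j).EE i (-(k : ℂ)) := by
  unfold REG
  rw [(D.cone j).RR_zero (k + 1) k (by omega)]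
  have : (D.cone j).EE (k + 1) (-(k : ℂ)) = 0 := by
    unfold LCone.EE
    rw [(D.cone j).g_zero k _ (by omega) _ ⟨by positivity, le_rfl⟩,
      (D.cone j).g_zero k _ (by omega) _ ⟨le_rfl, by positivity⟩]
    simp
  rw [this]
  simp

lemma zeta_diff_im (c : ℝ) (s : ℂ) (hs : s.im ≠ 0) :
    DifferentiableAt ℂ (fun s : ℂ => riemannZeta (2 * s + c)) s := by
  have h : 2 * s + (c : ℂ) ≠ 1 := by
    intro h
    have := congrArg Complex.im h
    simp at this
    exact hs this
  exact DifferentiableAt.comp (f := fun s : ℂ => 2 * s + c) s (differentiableAt_riemannZeta h) (by fun_prop)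

lemma WW_diff (k j : ℕ) (s : ℂ) (h1 : -((k : ℝ) + 1) < s.re) (h2 : s.im ≠ 0) :
    DifferentiableAt ℂ ((D.cone j).WW (k + 1)) s := by
  unfold LCone.WW
  refine DifferentiableAt.add (DifferentiableAt.add ?_ ?_) ?_
  · refine DifferentiableAt.mul ?_ ((D.cone j).II_diff _)
    have := zeta_diff_im (-1) s h2
    push_cast at this
    exact this
  · refine DifferentiableAt.fun_sum fun i _ => ?_
    refine DifferentiableAt.mul (DifferentiableAt.mul (differentiableAt_const _) ?_) ((D.cone j).EE_diff i _)
    have := zeta_diff_im (2 * i + 1) s h2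
    push_cast at this
    simp only [add_assoc]
    exact this
  · refine ((D.cone j).RR_diff (k + 1)).differentiableAt (IsOpen.mem_nhds ?_ ?_)
    · exact isOpen_lt continuous_const Complex.continuous_re
    · simpa using h1

theorem value (k : ℕ) (Z : ℂ → ℂ) (hZ : DifferentiableOn ℂ Z {(1 : ℂ)}ᶜ)
    (hZeq : ∀ s : ℂ, 1 < s.re → Z s = ∑ j ∈ Finset.range D.h, (D.cone j).WW (k + 1) s) :
    Z (-(k : ℂ)) = ∑ j ∈ Finset.range D.h, D.REG k j (-(k : ℂ)) +
      (bet (2 * k + 2) : ℂ) * (2 * k + 1) * ∑ j ∈ Finset.range D.h, D.JJ k j (-(k : ℂ)) := by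
  set U : Set ℂ := {s | -((k : ℝ) + 1) < s.re} ∩ {s | 0 < s.im} with hU
  have hUo : IsOpen U := (isOpen_lt continuous_const Complex.continuous_re).inter
    (isOpen_lt continuous_const Complex.continuous_im)
  have hUc : IsPreconnected U :=
    ((convex_halfSpace_re_gt _).inter (convex_halfSpace_im_gt _)).isPreconnected
  set WT : ℂ → ℂ := fun s => ∑ j ∈ Finset.range D.h, (D.cone j).WW (k + 1) s with hWT
  have hWTd : DifferentiableOn ℂ WT U := by
    intro s hs
    refine DifferentiableAt.differentiableWithinAt ?_
    refine DifferentiableAt.fun_sum fun j _ => D.WW_diff k j s hs.1 (ne_of_gt hs.2)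
  have hZd : DifferentiableOn ℂ Z U := hZ.mono (by
    intro s hs h
    have : s = 1 := h
    subst this
    simpa using hs.2)
  have hEq : Set.EqOn Z WT U := by
    have hz0 : (2 + Complex.I : ℂ) ∈ U := by
      refine ⟨?_, ?_⟩
      · have : (0 : ℝ) ≤ k := by positivity
        simp; linarith
      · simp
    refine (hZd.analyticOnNhd hUo).eqOn_of_preconnected_of_eventuallyEq (hWTd.analyticOnNhd hUo) hUc hz0 ?_
    have : {s : ℂ | 1 < s.re} ∈ nhds (2 + Complex.I : ℂ) :=
      (isOpen_lt continuous_const Complex.continuous_re).mem_nhds (by simp)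
    filter_upwards [this] with s hs
    exact hZeq s hs
  set σ : ℝ → ℂ := fun τ => -(k : ℂ) + τ * Complex.I with hσ
  have hσc : Continuous σ := by fun_prop
  have hσt : Filter.Tendsto σ (nhdsWithin 0 (Set.Ioi 0)) (nhds (-(k : ℂ))) := by
    have := (hσc.tendsto 0).mono_left (nhdsWithin_le_nhds (s := Set.Ioi 0))
    simpa [hσ] using this
  have hZt : Filter.Tendsto (fun τ => Z (σ τ)) (nhdsWithin 0 (Set.Ioi 0)) (nhds (Z (-(k : ℂ)))) := by
    have : ContinuousAt Z (-(k : ℂ)) := by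
      refine hZ.continuousOn.continuousAt (isOpen_compl_singleton.mem_nhds ?_)
      intro h
      have h' : -(k : ℂ) = 1 := h
      apply nat_ne (k + 1) 0 (by omega)
      push_cast
      linear_combination -h'
    exact this.tendsto.comp hσt
  refine tendsto_nhds_unique hZt ?_
  have hres : Filter.Tendsto (fun τ => (2 * σ τ + 2 * k) * riemannZeta (2 * σ τ + 2 * k + 1))
      (nhdsWithin 0 (Set.Ioi 0)) (nhds 1) := by
    have h1 : Filter.Tendsto (fun τ => 2 * σ τ + 2 * k + 1) (nhdsWithin 0 (Set.Ioi 0)) (nhdsWithin 1 {1}ᶜ) := by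
      refine tendsto_nhdsWithin_iff.2 ⟨?_, ?_⟩
      · have hc : Continuous (fun s : ℂ => 2 * s + 2 * k + 1) := by fun_prop
        have := (hc.tendsto (-(k : ℂ))).comp hσt
        have e : 2 * (-(k : ℂ)) + 2 * k + 1 = 1 := by ring
        rw [e] at this
        exact this
      · filter_upwards [self_mem_nhdsWithin] with τ hτ h
        have h' : 2 * σ τ + 2 * k + 1 = 1 := h
        have := congrArg Complex.im h'
        simp [hσ] at this
        exact (ne_of_gt hτ) this
    have := riemannZeta_residue_one.comp h1
    refine this.congr fun τ => ?_
    simp only [Function.comp]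
    congr 1
    ring
  have hlim : Filter.Tendsto (fun τ => ∑ j ∈ Finset.range D.h, D.REG k j (σ τ) +
      (bet (2 * k + 2) : ℂ) * (2 * k + 1) * ((2 * σ τ + 2 * k) * riemannZeta (2 * σ τ + 2 * k + 1)) *
        ∑ j ∈ Finset.range D.h, D.JJ k j (σ τ)) (nhdsWithin 0 (Set.Ioi 0))
      (nhds (∑ j ∈ Finset.range D.h, D.REG k j (-(k : ℂ)) +
      (bet (2 * k + 2) : ℂ) * (2 * k + 1) * 1 * ∑ j ∈ Finset.range D.h, D.JJ k j (-(k : ℂ)))) := by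
    refine Filter.Tendsto.add ?_ (Filter.Tendsto.mul (Filter.Tendsto.mul tendsto_const_nhds hres) ?_)
    · exact tendsto_finsetSum _ fun j _ => (D.REG_cont k j).tendsto.comp hσt
    · exact tendsto_finsetSum _ fun j _ => ((D.JJ_cont k j).tendsto _).comp hσt
  rw [mul_one] at hlim
  refine hlim.congr' ?_
  filter_upwards [self_mem_nhdsWithin] with τ hτ
  rw [← D.sum_WW]
  refine (hEq ⟨?_, ?_⟩).symm
  · simp [hσ]
  · simpa [hσ] using hτ

end CFD

/-! ### Part 6: matching with the differential operators -/

lemma pd2_sum {ι : Type} (S : Finset ι) (c : ι → ℝ) (p q : ι → ℕ) :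
    pd2 (fun h : ℝ × ℝ => ∑ n ∈ S, c n * h.1 ^ p n * h.2 ^ q n) =
      fun h : ℝ × ℝ => ∑ n ∈ S, (c n * q n) * h.1 ^ p n * h.2 ^ (q n - 1) := by
  funext h
  unfold pd2
  refine HasDerivAt.deriv ?_
  refine HasDerivAt.fun_sum fun n _ => ?_
  refine ((hasDerivAt_pow (q n) h.2).const_mul (c n * h.1 ^ p n)).congr_deriv ?_
  ring

lemma pd1_sum {ι : Type} (S : Finset ι) (c : ι → ℝ) (p q : ι → ℕ) :
    pd1 (fun h : ℝ × ℝ => ∑ n ∈ S, c n * h.1 ^ p n * h.2 ^ q n) =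
      fun h : ℝ × ℝ => ∑ n ∈ S, (c n * p n) * h.1 ^ (p n - 1) * h.2 ^ q n := by
  funext h
  unfold pd1
  refine HasDerivAt.deriv ?_
  refine HasDerivAt.fun_sum fun n _ => ?_
  refine (((hasDerivAt_pow (p n) h.1).const_mul (c n)).mul_const (h.2 ^ q n)).congr_deriv ?_
  ring

lemma pd2_iter {ι : Type} (S : Finset ι) (c : ι → ℝ) (p q : ι → ℕ) (b : ℕ) :
    pd2^[b] (fun h : ℝ × ℝ => ∑ n ∈ S, c n * h.1 ^ p n * h.2 ^ q n) =
      fun h : ℝ × ℝ => ∑ n ∈ S, (c n * (q n).descFactorial b) * h.1 ^ p n * h.2 ^ (q n - b) := by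
  induction b with
  | zero => simp
  | succ b ih =>
    rw [Function.iterate_succ_apply', ih, pd2_sum S (fun n => c n * (q n).descFactorial b) p (fun n => q n - b)]
    funext h
    apply Finset.sum_congr rfl
    intro n _
    rw [Nat.descFactorial_succ, Nat.sub_sub]
    push_cast
    ring

lemma pd1_iter {ι : Type} (S : Finset ι) (c : ι → ℝ) (p q : ι → ℕ) (b : ℕ) :
    pd1^[b] (fun h : ℝ × ℝ => ∑ n ∈ S, c n * h.1 ^ p n * h.2 ^ q n) =
      fun h : ℝ × ℝ => ∑ n ∈ S, (c n * (p n).descFactorial b) * h.1 ^ (p n - b) * h.2 ^ q n := by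
  induction b with
  | zero => simp
  | succ b ih =>
    rw [Function.iterate_succ_apply', ih, pd1_sum S (fun n => c n * (p n).descFactorial b) (fun n => p n - b) q]
    funext h
    apply Finset.sum_congr rfl
    intro n _
    rw [Nat.descFactorial_succ, Nat.sub_sub]
    push_cast
    ring

lemma pd_eval (k a b : ℕ) (hab : a + b = 2 * k) (c : ℕ → ℝ) :
    pd1^[a] (pd2^[b] (fun h : ℝ × ℝ => ∑ n ∈ Finset.range (2 * k + 1), c n * h.1 ^ (2 * k - n) * h.2 ^ n)) (0, 0) =
      a.factorial * b.factorial * c b := by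
  rw [pd2_iter (Finset.range (2 * k + 1)) c (fun n => 2 * k - n) (fun n => n),
    pd1_iter (Finset.range (2 * k + 1)) (fun n => c n * (n.descFactorial b)) (fun n => 2 * k - n)
    (fun n => n - b)]
  simp only
  rw [Finset.sum_eq_single b]
  · rw [Nat.descFactorial_self, show 2 * k - b = a by omega, Nat.descFactorial_self]
    simp
    ring
  · intro n hn hne
    rw [Finset.mem_range] at hn
    rcases lt_or_gt_of_ne hne with h | h
    · rw [Nat.descFactorial_of_lt h]; simp
    · rw [Nat.descFactorial_of_lt (show 2 * k - n < a by omega)]; simp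
  · intro h
    rw [Finset.mem_range] at h
    omega

lemma pd_coef (k a b : ℕ) (hab : a + b = 2 * k) (N X X' w w' : ℝ) :
    pd1^[a] (pd2^[b] (fun h : ℝ × ℝ => (N * (X * h.1 + w * h.2) * (X' * h.1 + w' * h.2)) ^ k)) (0, 0) =
      a.factorial * b.factorial * (N ^ k * coef k b X X' w w') := by
  rw [← pd_eval k a b hab (fun n => N ^ k * coef k n X X' w w')]
  have hfun : (fun h : ℝ × ℝ => (N * (X * h.1 + w * h.2) * (X' * h.1 + w' * h.2)) ^ k) =
      (fun h : ℝ × ℝ => ∑ n ∈ Finset.range (2 * k + 1), N ^ k * coef k n X X' w w' * h.1 ^ (2 * k - n) * h.2 ^ n) := by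
    funext h
    have := coef_expand k X X' w w' h.1 h.2
    rw [mul_assoc, mul_pow, mul_comm X, mul_comm w, mul_comm X', mul_comm w', this, Finset.mul_sum]
    apply Finset.sum_congr rfl
    intro n _
    ring
  rw [hfun]

lemma coef_symm (k n : ℕ) (hn : n ≤ 2 * k) (X X' w w' : ℝ) :
    coef k (2 * k - n) X X' w w' = coef k n w w' X X' := by
  have h1 := pd_eval k (2 * k - n) n (by omega) (fun n => coef k n w w' X X')
  have h2 := pd_eval k (2 * k - n) n (by omega) (fun n => coef k (2 * k - n) X X' w w')
  have e : (fun h : ℝ × ℝ => ∑ n ∈ Finset.range (2 * k + 1), coef k n w w' X X' * h.1 ^ (2 * k - n) * h.2 ^ n) =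
      (fun h : ℝ × ℝ => ∑ n ∈ Finset.range (2 * k + 1), coef k (2 * k - n) X X' w w' * h.1 ^ (2 * k - n) * h.2 ^ n) := by
    funext h
    rw [← coef_expand, add_comm, add_comm (h.1 * w'), coef_expand, ← Finset.sum_range_reflect]
    apply Finset.sum_congr rfl
    intro n hn
    rw [Finset.mem_range] at hn
    rw [show 2 * k + 1 - 1 - n = 2 * k - n by omega, show 2 * k - (2 * k - n) = n by omega]
    ring
  rw [e, h2] at h1
  exact mul_left_cancel₀ (by positivity) h1

lemma coef_neg (k n : ℕ) (X X' w w' : ℝ) : coef k n X X' (-w) (-w') = (-1) ^ n * coef k n X X' w w' := by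
  unfold coef
  rw [Finset.mul_sum]
  apply Finset.sum_congr rfl
  rintro ⟨l, m⟩ h
  rw [Finset.HasAntidiagonal.mem_antidiagonal] at h
  simp only at h ⊢
  rw [← h, neg_pow w, neg_pow w', pow_add]
  ring

lemma beta_int (p q : ℕ) : ∫ t in (0 : ℝ)..1, (1 - t) ^ p * t ^ q =
    (p.factorial : ℝ) * q.factorial / (p + q + 1).factorial := by
  induction p generalizing q with
  | zero =>
    simp only [pow_zero, one_mul, integral_pow]
    rw [show 0 + q + 1 = q + 1 by ring, Nat.factorial_succ]
    have : (q.factorial : ℝ) ≠ 0 := by positivity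
    push_cast
    field_simp
    simp
  | succ p ih =>
    have hd : ∀ t : ℝ, HasDerivAt (fun t : ℝ => (1 - t) ^ (p + 1) * t ^ (q + 1))
        ((q + 1) * ((1 - t) ^ (p + 1) * t ^ q) - (p + 1) * ((1 - t) ^ p * t ^ (q + 1))) t := by
      intro t
      have h1 : HasDerivAt (fun t : ℝ => 1 - t) (-1) t := (hasDerivAt_id t).const_sub 1
      refine ((h1.pow (p + 1)).mul (hasDerivAt_pow (q + 1) t)).congr_deriv ?_
      simp
      ring
    have h2 := intervalIntegral.integral_eq_sub_of_hasDerivAt (a := 0) (b := 1) (fun t _ => hd t)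
      (Continuous.intervalIntegrable (by fun_prop) _ _)
    rw [intervalIntegral.integral_sub (Continuous.intervalIntegrable (by fun_prop) _ _)
      (Continuous.intervalIntegrable (by fun_prop) _ _), intervalIntegral.integral_const_mul,
      intervalIntegral.integral_const_mul, ih] at h2
    simp only [sub_self, ne_eq, Nat.add_eq_zero_iff, one_ne_zero, and_false, not_false_eq_true, zero_pow,
      mul_zero, zero_mul] at h2
    rw [show p + (q + 1) + 1 = p + 1 + q + 1 by ring] at h2
    rw [Nat.factorial_succ p]
    rw [Nat.factorial_succ q] at h2
    have hq : ((q : ℝ) + 1) ≠ 0 := by positivity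
    apply mul_left_cancel₀ hq
    push_cast at h2 ⊢
    linear_combination h2

lemma R_int (k a : ℕ) (X X' z z' : ℝ) : (a : ℝ) * ∑ j ∈ Finset.range (2 * k + 1),
    (j.factorial : ℝ) * (2 * k - j).factorial * coef k (2 * k - j) X X' (a * z + X) (a * z' + X') =
    (2 * k + 1).factorial * ∫ τ in (0 : ℝ)..a, ((X + τ * z) * (X' + τ * z')) ^ k := by
  have h1 : ∫ τ in (0 : ℝ)..a, ((X + τ * z) * (X' + τ * z')) ^ k =
      a * ∫ t in (0 : ℝ)..1, ((X + (a * t) * z) * (X' + (a * t) * z')) ^ k := by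
    have := intervalIntegral.mul_integral_comp_mul_left (a := 0) (b := 1)
      (f := fun τ : ℝ => ((X + τ * z) * (X' + τ * z')) ^ k) (a : ℝ)
    rw [this]
    simp
  have h2 : ∀ t : ℝ, ((X + (a * t) * z) * (X' + (a * t) * z')) ^ k =
      ∑ n ∈ Finset.range (2 * k + 1), coef k n X X' (a * z + X) (a * z' + X') * ((1 - t) ^ (2 * k - n) * t ^ n) := by
    intro t
    have := coef_expand k X X' (a * z + X) (a * z' + X') (1 - t) t
    simp only [← mul_assoc]
    rw [← this]
    congr 1
    ring
  rw [h1]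
  simp only [h2]
  rw [intervalIntegral.integral_finset_sum (fun n _ => Continuous.intervalIntegrable (by fun_prop) _ _)]
  simp only [intervalIntegral.integral_const_mul, beta_int]
  rw [mul_left_comm]
  congr 1
  rw [Finset.mul_sum, ← Finset.sum_range_reflect]
  apply Finset.sum_congr rfl
  intro n hn
  rw [Finset.mem_range] at hn
  rw [show 2 * k + 1 - 1 - n = 2 * k - n by omega, show 2 * k - (2 * k - n) = n by omega,
    show 2 * k - n + n + 1 = 2 * k + 1 by omega]
  have : ((2 * k + 1).factorial : ℝ) ≠ 0 := by positivity
  field_simp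

def betp (n : ℕ) : ℝ := (bernoulli' n : ℝ) / (n.factorial : ℝ)

lemma betp_eq (n : ℕ) (hn : n ≠ 1) : betp n = bet n := by
  unfold betp bet
  rw [bernoulli_eq_bernoulli'_of_ne_one hn]

def Lsum (k : ℕ) (X X' w w' : ℝ) : ℝ := ∑ i ∈ Finset.range k,
  bet (2 * i + 2) * bet (2 * k - 2 * i) * ((2 * i + 1).factorial * (2 * k - 2 * i - 1).factorial) *
    coef k (2 * i + 1) X X' w w'

lemma Lsum_symm (k : ℕ) (X X' w w' : ℝ) : Lsum k X X' w w' = Lsum k w w' X X' := by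
  unfold Lsum
  rw [← Finset.sum_range_reflect]
  apply Finset.sum_congr rfl
  intro i hi
  rw [Finset.mem_range] at hi
  rw [← coef_symm k (2 * i + 1) (by omega)]
  rw [show 2 * (k - 1 - i) + 2 = 2 * k - 2 * i by omega, show 2 * k - 2 * (k - 1 - i) = 2 * i + 2 by omega,
    show 2 * (k - 1 - i) + 1 = 2 * k - (2 * i + 1) by omega, show 2 * i + 2 - 1 = 2 * i + 1 by omega,
    show 2 * k - 2 * i - 1 = 2 * k - (2 * i + 1) by omega]
  ring

lemma sum_parity (k : ℕ) (F : ℕ → ℝ) : ∑ n ∈ Finset.range (2 * k + 1), F n =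
    ∑ i ∈ Finset.range k, F (2 * i + 1) + ∑ i ∈ Finset.range (k + 1), F (2 * i) := by
  induction k with
  | zero => simp
  | succ k ih =>
    rw [show 2 * (k + 1) + 1 = 2 * k + 1 + 1 + 1 by ring, Finset.sum_range_succ, Finset.sum_range_succ, ih,
      Finset.sum_range_succ (fun i => F (2 * i + 1)), Finset.sum_range_succ (fun i => F (2 * i)) (k + 1)]
    rw [show 2 * (k + 1) = 2 * k + 1 + 1 by ring]
    ring

lemma L_eval (k : ℕ) (X X' w w' : ℝ) : ∑ j ∈ Finset.Icc 1 (2 * k + 1), betp j * betp (2 * k + 2 - j) *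
    ((j - 1).factorial * (2 * k + 1 - j).factorial * coef k (2 * k + 1 - j) X X' (-w) (-w')) =
    -Lsum k w w' X X' + (if k = 0 then 1 / 4 else 0) := by
  have h1 : Finset.Icc 1 (2 * k + 1) = Finset.Ico (0 + 1) (2 * k + 1 + 1) := by
    ext j; simp
  rw [h1, ← Finset.sum_Ico_add', ← Finset.range_eq_Ico, sum_parity]
  congr 1
  · unfold Lsum
    rw [← Finset.sum_neg_distrib]
    apply Finset.sum_congr rfl
    intro i hi
    rw [Finset.mem_range] at hi
    rw [show 2 * i + 1 + 1 - 1 = 2 * i + 1 by omega, show 2 * k + 1 - (2 * i + 1 + 1) = 2 * k - (2 * i + 1) by omega,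
      coef_neg, coef_symm k _ (by omega), betp_eq _ (by omega), betp_eq _ (by omega),
      Odd.neg_one_pow ⟨k - i - 1, by omega⟩, show 2 * k + 2 - (2 * i + 1 + 1) = 2 * k - 2 * i by omega,
      show 2 * k - 2 * i - 1 = 2 * k - (2 * i + 1) by omega]
    ring
  · rcases eq_or_ne k 0 with rfl | hk
    · simp [betp, coef, bernoulli'_one]
      norm_num
    · rw [if_neg hk]
      apply Finset.sum_eq_zero
      intro i hi
      rw [Finset.mem_range] at hi
      rcases eq_or_ne i 0 with rfl | h0
      · rw [show 2 * k + 2 - (2 * 0 + 1) = 2 * k + 1 by omega, betp_eq (2 * k + 1) (by omega),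
          bet_odd k (by omega)]
        simp
      · rw [betp_eq (2 * i + 1) (by omega), bet_odd i (by omega)]
        simp

lemma zeta_bet (m : ℕ) (hm : 1 ≤ m) :
    riemannZeta (-((2 * m - 1 : ℕ) : ℂ)) = ((-(bet (2 * m) * (2 * m - 1).factorial) : ℝ) : ℂ) := by
  rw [riemannZeta_neg_nat_eq_bernoulli', show 2 * m - 1 + 1 = 2 * m by omega,
    ← bernoulli_eq_bernoulli'_of_ne_one (by omega)]
  have h2 : (2 * m).factorial = (2 * m) * (2 * m - 1).factorial := by
    have := Nat.factorial_succ (2 * m - 1)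
    rwa [show 2 * m - 1 + 1 = 2 * m by omega] at this
  have e : (((2 * m - 1 : ℕ) : ℂ) + 1) = ((2 * m : ℕ) : ℂ) := by
    rw [← Nat.cast_succ]; congr 1; omega
  rw [e]
  unfold bet
  rw [h2]
  have : ((2 * m - 1).factorial : ℂ) ≠ 0 := by exact_mod_cast (Nat.factorial_pos _).ne'
  have : (m : ℂ) ≠ 0 := by exact_mod_cast (show m ≠ 0 by omega)
  push_cast
  field_simp

namespace CFD

variable (D : CFD)

def LT (k i : ℕ) : ℝ := ∑ j ∈ Finset.Icc 1 (2 * k + 1), betp j * betp (2 * k + 2 - j) *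
  (pd1^[j - 1] (pd2^[2 * k + 1 - j] (fun h : ℝ × ℝ =>
    (D.N * (D.x (i + 2) * h.1 - D.x (i + 1) * h.2) * (D.x' (i + 2) * h.1 - D.x' (i + 1) * h.2)) ^ k)) (0, 0))

def RT (k i : ℕ) : ℝ := ∑ j ∈ Finset.range (2 * k + 1),
  (pd1^[j] (pd2^[2 * k - j] (fun h : ℝ × ℝ =>
    (D.N * (D.x i * h.1 + D.x (i + 2) * h.2) * (D.x' i * h.1 + D.x' (i + 2) * h.2)) ^ k)) (0, 0))

lemma LT_eq (k i : ℕ) : D.LT k i = D.N ^ k * (-Lsum k (D.x (i + 1)) (D.x' (i + 1)) (D.x (i + 2)) (D.x' (i + 2)) +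
    (if k = 0 then 1 / 4 else 0)) := by
  rw [← L_eval, Finset.mul_sum]
  unfold LT
  apply Finset.sum_congr rfl
  intro j hj
  rw [Finset.mem_Icc] at hj
  have := pd_coef k (j - 1) (2 * k + 1 - j) (by omega) D.N (D.x (i + 2)) (D.x' (i + 2)) (-D.x (i + 1)) (-D.x' (i + 1))
  simp only [neg_mul, ← sub_eq_add_neg] at this
  rw [this]
  ring

lemma RT_eq (k i : ℕ) : D.b i * D.RT k i = D.N ^ k * ((2 * k + 1).factorial *
    ∫ τ in (0 : ℝ)..D.b i, ((D.x i + τ * D.x (i + 1)) * (D.x' i + τ * D.x' (i + 1))) ^ k) := by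
  rw [← R_int, ← mul_assoc, mul_comm (D.N ^ k), mul_assoc]
  congr 1
  unfold RT
  rw [Finset.mul_sum]
  apply Finset.sum_congr rfl
  intro j hj
  rw [Finset.mem_range] at hj
  rw [pd_coef k j (2 * k - j) (by omega), D.hrec, D.hrec']
  ring

lemma JJ_val (k j : ℕ) : (bet (2 * k + 2) : ℂ) * (2 * k + 1) * D.JJ k j (-(k : ℂ)) =
    ((bet (2 * k + 2) * (D.b (2 * j) * D.RT k (2 * j)) : ℝ) : ℂ) := by
  rw [RT_eq]
  unfold JJ
  have : ∀ τ : ℝ, TT (2 * k) (-(k : ℂ)) D.N (D.x (2 * j + 1)) (D.x' (2 * j + 1))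
    (D.x (2 * j) + τ * D.x (2 * j + 1)) (D.x' (2 * j) + τ * D.x' (2 * j + 1)) =
    ((((2 * k).factorial * D.N ^ k) * ((D.x (2 * j) + τ * D.x (2 * j + 1)) * (D.x' (2 * j) + τ * D.x' (2 * j + 1))) ^ k : ℝ) : ℂ) := by
    intro τ
    rw [TT_neg_nat k _ _ _ _ _ _ D.hN (D.hpos _) (D.hpos' _), coef_top, mul_assoc]
  simp only [this]
  rw [intervalIntegral.integral_ofReal, intervalIntegral.integral_const_mul, Nat.factorial_succ]
  push_cast
  ring

lemma II_val (k j : ℕ) : riemannZeta (2 * (-(k : ℂ)) - 1) * (D.cone j).II (-(k : ℂ)) =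
    ((-(bet (2 * k + 2) * (D.b (2 * j + 1) * D.RT k (2 * j + 1))) : ℝ) : ℂ) := by
  have hz := zeta_bet (k + 1) (by omega)
  rw [show 2 * (k + 1) - 1 = 2 * k + 1 by omega, show 2 * (k + 1) = 2 * k + 2 by ring] at hz
  rw [show 2 * (-(k : ℂ)) - 1 = -((2 * k + 1 : ℕ) : ℂ) by push_cast; ring, hz, RT_eq]
  unfold LCone.II
  have : ∀ y ∈ Set.uIcc (0 : ℝ) (D.cone j).a, (D.cone j).g (-(k : ℂ)) 0 y =
      ((D.N ^ k * ((D.x (2 * j + 1) + y * D.x (2 * j + 2)) * (D.x' (2 * j + 1) + y * D.x' (2 * j + 2))) ^ k : ℝ) : ℂ) := by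
    intro y hy
    rw [Set.uIcc_of_le (by positivity)] at hy
    unfold LCone.g
    rw [TT_neg_nat k _ _ _ _ _ _ (D.cone j).hN ((D.cone j).h1 y hy) ((D.cone j).h2 y hy)]
    simp [cone, coef, mul_pow]
  rw [intervalIntegral.integral_congr this, intervalIntegral.integral_ofReal, intervalIntegral.integral_const_mul]
  simp only [cone]
  push_cast
  ring

lemma EE_val (k j : ℕ) : ∑ i ∈ Finset.range k, (bet (2 * i + 2) : ℂ) * riemannZeta (2 * (-(k : ℂ)) + 2 * i + 1) *
      (D.cone j).EE i (-(k : ℂ)) = ((-D.LT k (2 * j) + D.LT k (2 * j + 1) : ℝ) : ℂ) := by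
  rw [LT_eq, LT_eq, Lsum_symm k (D.x (2 * j + 1 + 1))]
  have e : ∀ a b d : ℝ, -(D.N ^ k * (-a + d)) + D.N ^ k * (-b + d) = D.N ^ k * (a - b) := by intros; ring
  rw [e]
  unfold Lsum
  rw [← Finset.sum_sub_distrib, Finset.mul_sum, Complex.ofReal_sum]
  apply Finset.sum_congr rfl
  intro i hi
  rw [Finset.mem_range] at hi
  have hz := zeta_bet (k - i) (by omega)
  have h1 : 2 * (-(k : ℂ)) + 2 * i + 1 = -((2 * (k - i) - 1 : ℕ) : ℂ) := by
    have : ((2 * (k - i) - 1 : ℕ) : ℂ) + 1 + 2 * i = 2 * k := by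
      exact_mod_cast (show 2 * (k - i) - 1 + 1 + 2 * i = 2 * k by omega)
    linear_combination this
  rw [h1, hz]
  have hE : (D.cone j).EE i (-(k : ℂ)) = (((2 * i + 1).factorial * D.N ^ k *
      (coef k (2 * i + 1) (D.x (2 * j + 1 + 2)) (D.x' (2 * j + 1 + 2)) (D.x (2 * j + 2)) (D.x' (2 * j + 2)) -
       coef k (2 * i + 1) (D.x (2 * j + 1)) (D.x' (2 * j + 1)) (D.x (2 * j + 2)) (D.x' (2 * j + 2))) : ℝ) : ℂ) := by
    unfold LCone.EE LCone.g
    rw [TT_neg_nat k _ _ _ _ _ _ (D.cone j).hN ((D.cone j).h1 _ ⟨by positivity, le_rfl⟩)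
        ((D.cone j).h2 _ ⟨by positivity, le_rfl⟩),
      TT_neg_nat k _ _ _ _ _ _ (D.cone j).hN ((D.cone j).h1 _ ⟨le_rfl, by positivity⟩)
        ((D.cone j).h2 _ ⟨le_rfl, by positivity⟩)]
    rw [D.hrec (2 * j + 1), D.hrec' (2 * j + 1)]
    simp only [cone, zero_mul, add_zero]
    rw [add_comm (D.x (2 * j + 1)), add_comm (D.x' (2 * j + 1))]
    push_cast
    ring
  rw [hE, show 2 * (k - i) = 2 * k - 2 * i by omega]
  rw [show 2 * j + 1 + 1 = 2 * j + 2 by ring]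
  push_cast
  ring

theorem value_final (k : ℕ) (Z : ℂ → ℂ) (hZ : DifferentiableOn ℂ Z {(1 : ℂ)}ᶜ)
    (hZeq : ∀ s : ℂ, 1 < s.re → Z s = ∑ j ∈ Finset.range D.h, (D.cone j).WW (k + 1) s) :
    Z (-(k : ℂ)) = ((∑ i ∈ Finset.range (2 * D.h), (-1 : ℝ) ^ (i + 1) * D.LT k i +
      betp (2 * k + 2) * ∑ i ∈ Finset.range (2 * D.h), (-1 : ℝ) ^ i * D.b i * D.RT k i : ℝ) : ℂ) := by
  have hpair : ∀ (n : ℕ) (F : ℕ → ℝ), ∑ i ∈ Finset.range (2 * n), F i =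
      ∑ j ∈ Finset.range n, (F (2 * j) + F (2 * j + 1)) := by
    intro n F
    induction n with
    | zero => simp
    | succ n ih =>
      rw [show 2 * (n + 1) = 2 * n + 1 + 1 by ring, Finset.sum_range_succ, Finset.sum_range_succ, ih,
        Finset.sum_range_succ]
      ring
  rw [D.value k Z hZ hZeq, hpair, hpair, Finset.mul_sum, Finset.mul_sum, ← Finset.sum_add_distrib,
    ← Finset.sum_add_distrib, Complex.ofReal_sum]
  apply Finset.sum_congr rfl
  intro j _
  rw [REG_val, JJ_val, II_val, EE_val, betp_eq _ (by omega)]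
  have h1 : (-1 : ℝ) ^ (2 * j) = 1 := by simp
  rw [← Complex.ofReal_add, ← Complex.ofReal_add]
  congr 1
  simp only [pow_succ, h1]
  ring

end CFD

/-! ### Part 7: assembling -/

namespace CFD

lemma lattice_total (D : CFD) (k : ℕ) (ω ω' : ℝ) (hω : 1 < ω) (hω' : ω' < 0) (hh : 1 ≤ D.h) (al be : ℕ → ℤ)
    (hx : ∀ i ≤ 2 * D.h + 1, D.x i = al i * ω + be i)
    (hx' : ∀ i ≤ 2 * D.h + 1, D.x' i = al i * ω' + be i)
    (hal : ∀ i < 2 * D.h, al (i + 2) = D.b i * al (i + 1) + al i)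
    (hbe : ∀ i < 2 * D.h, be (i + 2) = D.b i * be (i + 1) + be i)
    (ha1 : al 1 = 0) (hb1 : be 1 = 1) (ha2 : al 2 = 1) (hb2 : be 2 = 0) (hb : ∀ i, 1 ≤ D.b i)
    (s : ℂ) (hs : 1 < s.re) :
    HasSum (fun M : ℤ × ℤ => (wt (0, 1) ((al (2 * D.h + 1) : ℝ), (be (2 * D.h + 1) : ℝ)) M : ℂ) *
      Complex.exp (-s * Complex.log ((D.N * (M.1 * ω + M.2) * (M.1 * ω' + M.2) : ℝ) : ℂ)))
      (∑ j ∈ Finset.range D.h, (D.cone j).WW (k + 1) s) := by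
  have hdet : ∀ i < 2 * D.h, be (i + 1) * al (i + 2) - al (i + 1) * be (i + 2) = (-1) ^ i := by
    intro i
    induction i with
    | zero => intro _; simp [ha1, hb1, ha2, hb2]
    | succ i ih =>
      intro hi
      rw [hal (i + 1) hi, hbe (i + 1) hi, pow_succ]
      have := ih (by omega)
      rw [show i + 1 + 1 = i + 2 by ring]
      linear_combination -this
  have hapos : ∀ i < 2 * D.h, 0 ≤ al (i + 1) ∧ 1 ≤ al (i + 2) := by
    intro i
    induction i with
    | zero => intro _; simp [ha1, ha2]
    | succ i ih =>
      intro hi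
      obtain ⟨h1, h2⟩ := ih (by omega)
      refine ⟨by rw [show i + 1 + 1 = i + 2 by ring]; omega, ?_⟩
      rw [hal (i + 1) hi, show i + 1 + 1 = i + 2 by ring]
      have h3 : (1 : ℤ) ≤ D.b (i + 1) := by exact_mod_cast hb (i + 1)
      nlinarith
  have hp : 0 < al (2 * D.h + 1) := by
    have := (hapos (2 * D.h - 1) (by omega)).2
    rw [show 2 * D.h - 1 + 2 = 2 * D.h + 1 by omega] at this
    omega
  have hq : 0 < (al (2 * D.h + 1) : ℝ) * ω' + be (2 * D.h + 1) := by
    rw [← hx' _ le_rfl]; exact D.hpos' D.h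
  have hcone : ∀ j ∈ Finset.range D.h, HasSum (fun M : ℤ × ℤ =>
      (cw ω ω' (al (2 * j + 1), be (2 * j + 1)) (al (2 * (j + 1) + 1), be (2 * (j + 1) + 1)) M : ℂ) *
      Complex.exp (-s * Complex.log ((D.N * (M.1 * ω + M.2) * (M.1 * ω' + M.2) : ℝ) : ℂ)))
      ((D.cone j).WW (k + 1) s) := by
    intro j hj
    rw [Finset.mem_range] at hj
    have := (D.cone j).hasSum_lattice (k + 1) ω ω' (al (2 * j + 1), be (2 * j + 1)) (al (2 * j + 2), be (2 * j + 2))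
      (by have := hdet (2 * j) (by omega); simpa using this)
      (hx _ (by omega)) (hx' _ (by omega)) (hx _ (by omega)) (hx' _ (by omega))
      (D.hpos _) (D.hneg' (j + 1)) s hs
    have e1 := hal (2 * j + 1) (by omega)
    have e2 := hbe (2 * j + 1) (by omega)
    rw [show 2 * (j + 1) + 1 = 2 * j + 1 + 2 by ring, e1, e2]
    simp only [cone] at this
    rw [add_comm (al (2 * j + 1)), add_comm (be (2 * j + 1))] at this
    exact this
  refine (hasSum_sum hcone).congr_fun fun M => ?_
  rw [wt_eq ω ω' hω hω' _ _ hp hq, ← Finset.sum_mul]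
  congr 1
  rw [← Complex.ofReal_sum]
  congr 1
  unfold cw
  split_ifs with h
  · simp only
    have := Finset.sum_range_sub' (fun j => tht (be (2 * j + 1) * M.1 - al (2 * j + 1) * M.2)) D.h
    rw [this]
    simp [ha1, hb1]
  · simp

end CFD

/-- index map -/
def idx (ℓ i : ℕ) : ℕ := (ℓ - 1) * i + 1

/-- the numbers `A_{i-2}` -/
def xs (W : ℕ → ℝ) (ℓ i : ℕ) : ℝ := (∏ m ∈ Finset.range i, W (idx ℓ m)) * (W 1)⁻¹

lemma per_mul {T : Type} (f : ℕ → T) (ℓ : ℕ) (h : ∀ i, f (i + ℓ) = f i) (i m : ℕ) : f (i + ℓ * m) = f i := by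
  induction m with
  | zero => simp
  | succ m ih => rw [show i + ℓ * (m + 1) = i + ℓ * m + ℓ by ring, h, ih]

lemma idx_succ (ℓ i : ℕ) (hℓ : 1 ≤ ℓ) : idx ℓ (i + 1) + 1 = idx ℓ i + ℓ := by
  obtain ⟨l, rfl⟩ := Nat.exists_eq_add_of_le hℓ
  simp [idx]
  ring

lemma xs_succ (W : ℕ → ℝ) (ℓ i : ℕ) : xs W ℓ (i + 1) = xs W ℓ i * W (idx ℓ i) := by
  unfold xs
  rw [Finset.prod_range_succ]
  ring

lemma xs_one (W : ℕ → ℝ) (ℓ : ℕ) (h : W 1 ≠ 0) : xs W ℓ 1 = 1 := by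
  simp [xs, idx, h]

lemma xs_rec (W : ℕ → ℝ) (ℓ : ℕ) (hℓ : 1 ≤ ℓ) (a : ℕ → ℤ) (hW : ∀ i, W i ≠ 0)
    (hrec : ∀ i, W i = a i + (W (i + 1))⁻¹) (hper : ∀ i, W (i + ℓ) = W i) (i : ℕ) :
    xs W ℓ (i + 2) = a (idx ℓ (i + 1)) * xs W ℓ (i + 1) + xs W ℓ i := by
  rw [xs_succ, hrec, idx_succ _ _ hℓ, hper, xs_succ]
  have := hW (idx ℓ i)
  field_simp

lemma xs_scale (W : ℕ → ℝ) (ℓ : ℕ) (hW : W 1 ≠ 0) (hper : ∀ i, W (i + ℓ) = W i) :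
    xs W ℓ ℓ = (∏ m ∈ Finset.range ℓ, W (idx ℓ m)) * xs W ℓ 0 ∧
    xs W ℓ (ℓ + 1) = (∏ m ∈ Finset.range ℓ, W (idx ℓ m)) * xs W ℓ 1 := by
  constructor
  · simp [xs]
  · rw [xs_succ, xs_one W ℓ hW]
    have : W (idx ℓ ℓ) = W 1 := by
      unfold idx
      rw [add_comm, mul_comm, per_mul W ℓ hper]
    rw [this]
    simp [xs, hW]

lemma idx_le (ℓ i : ℕ) (hi : i ≤ ℓ) (hℓ : 1 ≤ ℓ) : idx ℓ (i + 1) = (ℓ - i) + ℓ * i := by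
  obtain ⟨d, rfl⟩ := Nat.exists_eq_add_of_le hi
  unfold idx
  rw [Nat.add_sub_cancel_left]
  obtain ⟨l, hl⟩ := Nat.exists_eq_add_of_le hℓ
  have : i + d - 1 = l := by omega
  rw [this, hl]
  have : d + i = l + 1 := by omega
  have : (d : ℤ) + i = l + 1 := by exact_mod_cast this
  zify
  linear_combination -this

/-! ### Part 8: the continued fraction data and the final theorem -/

lemma xs_pos (W : ℕ → ℝ) (ℓ : ℕ) (hW : ∀ i, 1 < W i) (i : ℕ) : 0 < xs W ℓ i := by
  unfold xs
  have h1 : 0 < W 1 := by linarith [hW 1]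
  have h2 : 0 < ∏ m ∈ Finset.range i, W (idx ℓ m) :=
    Finset.prod_pos fun m _ => by linarith [hW (idx ℓ m)]
  positivity

lemma xs_sign (W : ℕ → ℝ) (ℓ : ℕ) (hW : ∀ i, W i < 0) (j : ℕ) :
    xs W ℓ (2 * j) < 0 ∧ 0 < xs W ℓ (2 * j + 1) := by
  have key : xs W ℓ (2 * j) < 0 := by
    induction j with
    | zero => simpa [xs] using hW 1
    | succ j ih =>
      rw [show 2 * (j + 1) = 2 * j + 1 + 1 by ring, xs_succ, xs_succ]
      exact mul_neg_of_pos_of_neg (mul_pos_of_neg_of_neg ih (hW _)) (hW _)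
  refine ⟨key, ?_⟩
  rw [xs_succ]
  exact mul_pos_of_neg_of_neg key (hW _)

lemma conj_bounds (a : ℕ → ℤ) (hapos : ∀ i, 1 ≤ a i) (W : ℕ → ℝ) (h0 : -1 < W 0) (h0' : W 0 < 0)
    (hrec : ∀ i, W i = a i + (W (i + 1))⁻¹) (i : ℕ) : -1 < W i ∧ W i < 0 := by
  induction i with
  | zero => exact ⟨h0, h0'⟩
  | succ i ih =>
    have h1 : (1 : ℝ) ≤ a i := by exact_mod_cast hapos i
    have h2 : (W (i + 1))⁻¹ < -1 := by linarith [hrec i, ih.2]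
    have h3 : W (i + 1) < 0 := inv_lt_zero.mp (by linarith)
    refine ⟨?_, h3⟩
    have h4 : W (i + 1) * (W (i + 1))⁻¹ = 1 := mul_inv_cancel₀ h3.ne
    nlinarith

/-- the continued fraction data attached to a periodic continued fraction -/
def mkCFD (N : ℝ) (hN : 0 < N) (h : ℕ) (hh : 1 ≤ h) (a : ℕ → ℤ) (hapos : ∀ i, 1 ≤ a i)
    (W W' : ℕ → ℝ) (hW : ∀ i, 1 < W i) (hW' : ∀ i, W' i < 0)
    (hrec : ∀ i, W i = a i + (W (i + 1))⁻¹) (hrec' : ∀ i, W' i = a i + (W' (i + 1))⁻¹)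
    (hper : ∀ i, W (i + 2 * h) = W i) (hper' : ∀ i, W' (i + 2 * h) = W' i) : CFD where
  N := N
  h := h
  b := fun i => (a (idx (2 * h) (i + 1))).toNat
  x := xs W (2 * h)
  x' := xs W' (2 * h)
  e := ∏ m ∈ Finset.range (2 * h), W (idx (2 * h) m)
  e' := ∏ m ∈ Finset.range (2 * h), W' (idx (2 * h) m)
  hN := hN
  hrec := by
    intro i
    have hb : (((a (idx (2 * h) (i + 1))).toNat : ℕ) : ℝ) = (a (idx (2 * h) (i + 1)) : ℝ) := by
      have := Int.toNat_of_nonneg (show 0 ≤ a (idx (2 * h) (i + 1)) by linarith [hapos (idx (2 * h) (i + 1))])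
      exact_mod_cast this
    rw [hb]
    exact xs_rec W (2 * h) (by omega) a (fun i => by linarith [hW i]) hrec hper i
  hrec' := by
    intro i
    have hb : (((a (idx (2 * h) (i + 1))).toNat : ℕ) : ℝ) = (a (idx (2 * h) (i + 1)) : ℝ) := by
      have := Int.toNat_of_nonneg (show 0 ≤ a (idx (2 * h) (i + 1)) by linarith [hapos (idx (2 * h) (i + 1))])
      exact_mod_cast this
    rw [hb]
    exact xs_rec W' (2 * h) (by omega) a (fun i => (hW' i).ne) hrec' hper' i
  hpos := xs_pos W _ hW
  hpos' := fun j => (xs_sign W' _ hW' j).2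
  hneg' := fun j => (xs_sign W' _ hW' j).1
  hee := by
    have hWn : ∀ i, W i ≠ 0 := fun i => by linarith [hW i]
    have hWn' : ∀ i, W' i ≠ 0 := fun i => (hW' i).ne
    have hdet : ∀ i, xs W (2 * h) (i + 1) * xs W' (2 * h) i - xs W' (2 * h) (i + 1) * xs W (2 * h) i
        = (-1) ^ i * (xs W (2 * h) 1 * xs W' (2 * h) 0 - xs W' (2 * h) 1 * xs W (2 * h) 0) := by
      intro i
      induction i with
      | zero => simp
      | succ i ih =>
        rw [show i + 1 + 1 = i + 2 by ring, xs_rec W (2 * h) (by omega) a hWn hrec hper i,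
          xs_rec W' (2 * h) (by omega) a hWn' hrec' hper' i, pow_succ]
        linear_combination -ih
    have h1 := hdet (2 * h)
    obtain ⟨s0, s1⟩ := xs_scale W (2 * h) (hWn 1) hper
    obtain ⟨s0', s1'⟩ := xs_scale W' (2 * h) (hWn' 1) hper'
    rw [s0, s1, s0', s1', pow_mul] at h1
    have hneg : xs W (2 * h) 1 * xs W' (2 * h) 0 - xs W' (2 * h) 1 * xs W (2 * h) 0 < 0 := by
      have p0 := xs_pos W (2 * h) hW 0
      have p1 := xs_pos W (2 * h) hW 1
      have q := xs_sign W' (2 * h) hW' 0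
      simp only [mul_zero, zero_add] at q
      nlinarith [mul_pos q.2 p0, mul_neg_of_pos_of_neg p1 q.1]
    apply mul_right_cancel₀ hneg.ne
    norm_num at h1
    linear_combination h1
  hs0 := (xs_scale W (2 * h) (by linarith [hW 1]) hper).1
  hs0' := (xs_scale W' (2 * h) (hW' 1).ne hper').1
  hs1 := (xs_scale W (2 * h) (by linarith [hW 1]) hper).2
  hs1' := (xs_scale W' (2 * h) (hW' 1).ne hper').2

lemma xs_lin (h : ℕ) (hh : 1 ≤ h) (a : ℕ → ℤ) (haper : ∀ i, a (i + 2 * h) = a i) (W : ℕ → ℝ)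
    (hW : ∀ i, W i ≠ 0)
    (hrec : ∀ i, W i = a i + (W (i + 1))⁻¹) (hper : ∀ i, W (i + 2 * h) = W i) (al be : ℕ → ℤ)
    (ha0 : al 0 = 1) (hb0 : be 0 = - a 0) (ha1 : al 1 = 0) (hb1 : be 1 = 1)
    (hal : ∀ i < 2 * h, al (i + 2) = a (idx (2 * h) (i + 1)) * al (i + 1) + al i)
    (hbe : ∀ i < 2 * h, be (i + 2) = a (idx (2 * h) (i + 1)) * be (i + 1) + be i) :
    ∀ i ≤ 2 * h + 1, xs W (2 * h) i = al i * W 0 + be i := by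
  have hx0 : xs W (2 * h) 0 = al 0 * W 0 + be 0 := by
    have := hrec 0
    simp only [zero_add] at this
    simp [xs, ha0, hb0]
    linarith
  have hx1 : xs W (2 * h) 1 = al 1 * W 0 + be 1 := by
    rw [xs_one W _ (hW 1)]; simp [ha1, hb1]
  have key : ∀ i ≤ 2 * h, xs W (2 * h) i = al i * W 0 + be i ∧
      xs W (2 * h) (i + 1) = al (i + 1) * W 0 + be (i + 1) := by
    intro i
    induction i with
    | zero => exact fun _ => ⟨hx0, hx1⟩
    | succ i ih =>
      intro hi
      obtain ⟨i1, i2⟩ := ih (by omega)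
      refine ⟨i2, ?_⟩
      rw [show i + 1 + 1 = i + 2 by ring, xs_rec W (2 * h) (by omega) a hW hrec hper i, i1, i2,
        hal i (by omega), hbe i (by omega)]
      push_cast
      ring
  intro i hi
  rcases Nat.lt_or_ge (2 * h) i with h1 | h1
  · rw [show i = 2 * h + 1 by omega]
    exact (key (2 * h) le_rfl).2
  · exact (key i h1).1

/-- the theorem over the reals -/
theorem real_main (N : ℝ) (hN : 0 < N) (h : ℕ) (hh : 1 ≤ h) (a : ℕ → ℤ) (hapos : ∀ i, 1 ≤ a i)
    (haper : ∀ i, a (i + 2 * h) = a i)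
    (W W' : ℕ → ℝ) (hW : ∀ i, 1 < W i) (hW0 : -1 < W' 0) (hW0' : W' 0 < 0)
    (hrec : ∀ i, W i = a i + (W (i + 1))⁻¹) (hrec' : ∀ i, W' i = a i + (W' (i + 1))⁻¹)
    (hper : ∀ i, W (i + 2 * h) = W i) (hper' : ∀ i, W' (i + 2 * h) = W' i)
    (α β : ℤ → ℤ) (hαm2 : α (-2) = 1) (hαm1 : α (-1) = 0) (hα0 : α 0 = 1)
    (hβm2 : β (-2) = -(a 0)) (hβm1 : β (-1) = 1) (hβ0 : β 0 = 0)
    (hαrec : ∀ i : ℕ, i < 2 * h →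
      α ((i : ℤ) + 1) = a (2 * h - 1 - i) * α (i : ℤ) + α ((i : ℤ) - 1))
    (hβrec : ∀ i : ℕ, i < 2 * h →
      β ((i : ℤ) + 1) = a (2 * h - 1 - i) * β (i : ℤ) + β ((i : ℤ) - 1))
    (Q : ℝ → ℝ → ℝ) (hQ : ∀ x y : ℝ, Q x y = N * (x * W 0 + y) * (x * W' 0 + y))
    (k : ℕ) (Z : ℂ → ℂ) (hZhol : DifferentiableOn ℂ Z {(1 : ℂ)}ᶜ)
    (hZeq : ∀ s : ℂ, 1 < s.re → Z s =
      ∑' m : ℤ × ℤ,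
        (wt (0, 1) ((α (((2 * h : ℕ) : ℤ) - 1) : ℝ), (β (((2 * h : ℕ) : ℤ) - 1) : ℝ)) m : ℂ) *
          Complex.exp (-s * Complex.log ((Q (m.1 : ℝ) (m.2 : ℝ) : ℝ)))) :
    Z (-(k : ℂ)) =
      ((∑ i ∈ Finset.range (2 * h), (-1 : ℝ) ^ (i + 1) *
          ∑ j ∈ Finset.Icc 1 (2 * k + 1),
            ((bernoulli' j : ℝ) / (j.factorial : ℝ)) *
              ((bernoulli' (2 * k + 2 - j) : ℝ) / ((2 * k + 2 - j).factorial : ℝ)) *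
              (pd1^[j - 1] (pd2^[2 * k + 1 - j] (fun h : ℝ × ℝ =>
                (Q ((α (i : ℤ) : ℝ) * h.1 - (α ((i : ℤ) - 1) : ℝ) * h.2)
                   ((β (i : ℤ) : ℝ) * h.1 - (β ((i : ℤ) - 1) : ℝ) * h.2)) ^ k)) (0, 0)))
        + ((bernoulli' (2 * k + 2) : ℝ) / ((2 * k + 2).factorial : ℝ)) *
          ∑ i ∈ Finset.range (2 * h), (-1 : ℝ) ^ i * (a (2 * h - i) : ℝ) *
            ∑ j ∈ Finset.range (2 * k + 1),
              (pd1^[j] (pd2^[2 * k - j] (fun h : ℝ × ℝ =>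
                (Q ((α ((i : ℤ) - 2) : ℝ) * h.1 + (α (i : ℤ) : ℝ) * h.2)
                   ((β ((i : ℤ) - 2) : ℝ) * h.1 + (β (i : ℤ) : ℝ) * h.2)) ^ k)) (0, 0))
        : ℝ) := by
  have hW' : ∀ i, W' i < 0 := fun i => (conj_bounds a hapos W' hW0 hW0' hrec' i).2
  have hidx : ∀ i ≤ 2 * h, a (idx (2 * h) (i + 1)) = a (2 * h - i) := by
    intro i hi
    rw [idx_le _ _ hi (by omega), per_mul a (2 * h) haper]
  have hrecAB : ∀ γ : ℤ → ℤ, γ 0 = a 0 * γ (-1) + γ (-2) → (∀ i : ℕ, i < 2 * h →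
      γ ((i : ℤ) + 1) = a (2 * h - 1 - i) * γ (i : ℤ) + γ ((i : ℤ) - 1)) →
      ∀ i < 2 * h, γ (((i + 2 : ℕ) : ℤ) - 2) =
        a (idx (2 * h) (i + 1)) * γ (((i + 1 : ℕ) : ℤ) - 2) + γ ((i : ℤ) - 2) := by
    intro γ h0 hr i hi
    rw [hidx i hi.le]
    rcases i with _ | i
    · have := haper 0
      simp only [zero_add] at this
      simp [this, h0]
    · have := hr i (by omega)
      rw [show ((i + 1 + 2 : ℕ) : ℤ) - 2 = (i : ℤ) + 1 by push_cast; ring,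
        show ((i + 1 + 1 : ℕ) : ℤ) - 2 = (i : ℤ) by push_cast; ring,
        show ((i + 1 : ℕ) : ℤ) - 2 = (i : ℤ) - 1 by push_cast; ring, this,
        show 2 * h - (i + 1) = 2 * h - 1 - i by omega]
  have hal := hrecAB α (by rw [hα0, hαm1, hαm2]; ring) hαrec
  have hbe := hrecAB β (by rw [hβ0, hβm1, hβm2]; ring) hβrec
  set D := mkCFD N hN h hh a hapos W W' hW hW' hrec hrec' hper hper' with hD
  have hDh : D.h = h := rfl
  have hDN : D.N = N := rfl
  have hbc : ∀ i, ((D.b i : ℕ) : ℤ) = a (idx (2 * h) (i + 1)) := fun i =>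
    Int.toNat_of_nonneg (show 0 ≤ a (idx (2 * h) (i + 1)) by linarith [hapos (idx (2 * h) (i + 1))])
  have hx : ∀ i ≤ 2 * h + 1, D.x i = (α ((i : ℤ) - 2) : ℝ) * W 0 + (β ((i : ℤ) - 2) : ℝ) :=
    xs_lin h hh a haper W (fun i => by linarith [hW i]) hrec hper
      (fun i => α ((i : ℤ) - 2)) (fun i => β ((i : ℤ) - 2))
      (by simpa using hαm2) (by simpa using hβm2) (by simpa using hαm1) (by simpa using hβm1) hal hbe
  have hx' : ∀ i ≤ 2 * h + 1, D.x' i = (α ((i : ℤ) - 2) : ℝ) * W' 0 + (β ((i : ℤ) - 2) : ℝ) :=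
    xs_lin h hh a haper W' (fun i => (hW' i).ne) hrec' hper'
      (fun i => α ((i : ℤ) - 2)) (fun i => β ((i : ℤ) - 2))
      (by simpa using hαm2) (by simpa using hβm2) (by simpa using hαm1) (by simpa using hβm1) hal hbe
  have hZ2 : ∀ s : ℂ, 1 < s.re → Z s = ∑ j ∈ Finset.range D.h, (D.cone j).WW (k + 1) s := by
    intro s hs
    have hL := D.lattice_total k (W 0) (W' 0) (hW 0) hW0' hh
      (fun i => α ((i : ℤ) - 2)) (fun i => β ((i : ℤ) - 2)) hx hx'
      (fun i hi => by simpa only [hbc] using hal i hi)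
      (fun i hi => by simpa only [hbc] using hbe i hi)
      (by simpa using hαm1) (by simpa using hβm1) (by simpa using hα0) (by simpa using hβ0)
      (fun i => by
        have h1 := hbc i
        have h2 := hapos (idx (2 * h) (i + 1))
        omega) s hs
    rw [hZeq s hs, ← hL.tsum_eq]
    apply tsum_congr
    intro m
    rw [hQ, hDN, hDh, show ((2 * h + 1 : ℕ) : ℤ) - 2 = ((2 * h : ℕ) : ℤ) - 1 by push_cast; ring]
  rw [D.value_final k Z hZhol hZ2, hDh]
  congr 1
  have e2 : ∀ i : ℕ, ((i + 2 : ℕ) : ℤ) - 2 = (i : ℤ) := fun i => by push_cast; ring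
  have e1 : ∀ i : ℕ, ((i + 1 : ℕ) : ℤ) - 2 = (i : ℤ) - 1 := fun i => by push_cast; ring
  congr 1
  · apply Finset.sum_congr rfl
    intro i hi
    have hi := Finset.mem_range.mp hi
    unfold CFD.LT betp
    rw [hx (i + 2) (by omega), hx' (i + 2) (by omega), hx (i + 1) (by omega), hx' (i + 1) (by omega),
      e2 i, e1 i, hDN]
    have : (fun p : ℝ × ℝ =>
                (Q ((α (i : ℤ) : ℝ) * p.1 - (α ((i : ℤ) - 1) : ℝ) * p.2)
                   ((β (i : ℤ) : ℝ) * p.1 - (β ((i : ℤ) - 1) : ℝ) * p.2)) ^ k) = fun p : ℝ × ℝ =>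
        (N * (((α (i : ℤ) : ℝ) * W 0 + β (i : ℤ)) * p.1 - ((α ((i : ℤ) - 1) : ℝ) * W 0 + β ((i : ℤ) - 1)) * p.2)
          * (((α (i : ℤ) : ℝ) * W' 0 + β (i : ℤ)) * p.1 - ((α ((i : ℤ) - 1) : ℝ) * W' 0 + β ((i : ℤ) - 1)) * p.2)) ^ k := by
      funext p
      rw [hQ]
      congr 1
      ring
    rw [this]
  · unfold betp
    congr 1
    apply Finset.sum_congr rfl
    intro i hi
    have hi := Finset.mem_range.mp hi
    have hb : ((D.b i : ℕ) : ℝ) = (a (2 * h - i) : ℝ) := by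
      rw [← hidx i hi.le, ← hbc i]
      norm_cast
    rw [hb]
    unfold CFD.RT
    rw [hx (i + 2) (by omega), hx' (i + 2) (by omega), hx i (by omega), hx' i (by omega), e2 i, hDN]
    have : (fun p : ℝ × ℝ =>
                (Q ((α ((i : ℤ) - 2) : ℝ) * p.1 + (α (i : ℤ) : ℝ) * p.2)
                   ((β ((i : ℤ) - 2) : ℝ) * p.1 + (β (i : ℤ) : ℝ) * p.2)) ^ k) = fun p : ℝ × ℝ =>
        (N * (((α ((i : ℤ) - 2) : ℝ) * W 0 + β ((i : ℤ) - 2)) * p.1 + ((α (i : ℤ) : ℝ) * W 0 + β (i : ℤ)) * p.2)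
          * (((α ((i : ℤ) - 2) : ℝ) * W' 0 + β ((i : ℤ) - 2)) * p.1 + ((α (i : ℤ) : ℝ) * W' 0 + β (i : ℤ)) * p.2)) ^ k := by
      funext p
      rw [hQ]
      congr 1
      ring
    rw [this]

/- STATEMENT 1: the partial zeta value ζ(−k,𝔟) expressed through the positive continued
fraction of ω, with `L_k(∂)` and `R_k(∂)` applied to powers of the quadratic form `Q`. -/
theorem stmt_1
    -- K is a real quadratic field with nontrivial automorphism `conj` and real embedding `ι`
    (K : Type) [Field K] [NumberField K] (hdeg : Module.finrank ℚ K = 2)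
    (ι : K →+* ℝ) (conj : K ≃ₐ[ℚ] K) (hconj : conj ≠ AlgEquiv.refl)
    -- 𝔟 is a nonzero integral ideal with 𝔟⁻¹ = ℤ + ℤω
    (𝔟 : Ideal (𝓞 K)) (h𝔟 : 𝔟 ≠ 0) (ω : K)
    (hinv : ∀ x : K, x ∈ ((𝔟 : FractionalIdeal (𝓞 K)⁰ K))⁻¹ ↔
      ∃ c d : ℤ, x = (c : K) + (d : K) * ω)
    (hω1 : 1 < ι ω) (hω'gt : -1 < ι (conj ω)) (hω'lt : ι (conj ω) < 0)
    -- purely periodic continued fraction expansion ω = [[a₀,…,a_{r−1}]]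
    (r : ℕ) (hr : 0 < r) (a : ℕ → ℤ) (hapos : ∀ i, 1 ≤ a i) (haper : ∀ i, a (i + r) = a i)
    (w : ℕ → K) (hw0 : w 0 = ω) (hwgt : ∀ i, 1 < ι (w i))
    (hwrec : ∀ i, w i = (a i : K) + (w (i + 1))⁻¹) (hwper : ∀ i, w (i + r) = w i)
    -- the even period
    (ℓ : ℕ) (hℓ : ℓ = if r % 2 = 0 then r else 2 * r)
    -- the sequences α, β (with α_{−2} = 1, β_{−2} = −a₀)
    (α β : ℤ → ℤ) (hαm2 : α (-2) = 1) (hαm1 : α (-1) = 0) (hα0 : α 0 = 1)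
    (hβm2 : β (-2) = -(a 0)) (hβm1 : β (-1) = 1) (hβ0 : β 0 = 0)
    (hαrec : ∀ i : ℕ, i < ℓ → α ((i : ℤ) + 1) = a (ℓ - 1 - i) * α (i : ℤ) + α ((i : ℤ) - 1))
    (hβrec : ∀ i : ℕ, i < ℓ → β ((i : ℤ) + 1) = a (ℓ - 1 - i) * β (i : ℤ) + β ((i : ℤ) - 1))
    -- the quadratic form Q(x,y) = N(𝔟)·(xω+y)(xω′+y), read through the real embedding
    (Q : ℝ → ℝ → ℝ)
    (hQ : ∀ x y : ℝ, Q x y =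
      (Ideal.absNorm 𝔟 : ℝ) * (x * ι ω + y) * (x * ι (conj ω) + y))
    (k : ℕ)
    -- Z is the analytic continuation of the zeta function of (Q, σ)
    (Z : ℂ → ℂ) (hZhol : DifferentiableOn ℂ Z {(1 : ℂ)}ᶜ)
    (hZeq : ∀ s : ℂ, 1 < s.re → Z s =
      ∑' m : ℤ × ℤ,
        (wt (0, 1) ((α ((ℓ : ℤ) - 1) : ℝ), (β ((ℓ : ℤ) - 1) : ℝ)) m : ℂ) *
          Complex.exp (-s * Complex.log ((Q (m.1 : ℝ) (m.2 : ℝ) : ℝ)))) :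
    Z (-(k : ℂ)) =
      ((∑ i ∈ Finset.range ℓ, (-1 : ℝ) ^ (i + 1) *
          -- L_k(∂_{h₁},∂_{h₂}) applied to Q(α_i h₁ − α_{i−1} h₂, β_i h₁ − β_{i−1} h₂)^k at 0
          ∑ j ∈ Finset.Icc 1 (2 * k + 1),
            ((bernoulli' j : ℝ) / (j.factorial : ℝ)) *
              ((bernoulli' (2 * k + 2 - j) : ℝ) / ((2 * k + 2 - j).factorial : ℝ)) *
              (pd1^[j - 1] (pd2^[2 * k + 1 - j] (fun h : ℝ × ℝ =>
                (Q ((α (i : ℤ) : ℝ) * h.1 - (α ((i : ℤ) - 1) : ℝ) * h.2)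
                   ((β (i : ℤ) : ℝ) * h.1 - (β ((i : ℤ) - 1) : ℝ) * h.2)) ^ k)) (0, 0)))
        + ((bernoulli' (2 * k + 2) : ℝ) / ((2 * k + 2).factorial : ℝ)) *
          ∑ i ∈ Finset.range ℓ, (-1 : ℝ) ^ i * (a (ℓ - i) : ℝ) *
            -- R_k(∂_{h₁},∂_{h₂}) applied to Q(α_{i−2} h₁ + α_i h₂, β_{i−2} h₁ + β_i h₂)^k at 0
            ∑ j ∈ Finset.range (2 * k + 1),
              (pd1^[j] (pd2^[2 * k - j] (fun h : ℝ × ℝ =>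
                (Q ((α ((i : ℤ) - 2) : ℝ) * h.1 + (α (i : ℤ) : ℝ) * h.2)
                   ((β ((i : ℤ) - 2) : ℝ) * h.1 + (β (i : ℤ) : ℝ) * h.2)) ^ k)) (0, 0))
        : ℝ) := by
  obtain ⟨h, rfl⟩ : ∃ h, ℓ = 2 * h := by
    split_ifs at hℓ with h2
    · exact ⟨r / 2, by omega⟩
    · exact ⟨r, hℓ⟩
  have hh : 1 ≤ h := by
    split_ifs at hℓ with h2 <;> omega
  have hmul : ∃ c, 2 * h = r * c := by
    split_ifs at hℓ with h2
    · exact ⟨1, by omega⟩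
    · exact ⟨2, by omega⟩
  obtain ⟨c, hc⟩ := hmul
  have perw : ∀ c i, w (i + r * c) = w i := by
    intro c
    induction c with
    | zero => simp
    | succ c ih => intro i; rw [mul_add, mul_one, ← add_assoc, hwper, ih]
  have pera : ∀ c i, a (i + r * c) = a i := by
    intro c
    induction c with
    | zero => simp
    | succ c ih => intro i; rw [mul_add, mul_one, ← add_assoc, haper, ih]
  have hN : (0 : ℝ) < (Ideal.absNorm 𝔟 : ℝ) := by
    have : Ideal.absNorm 𝔟 ≠ 0 := fun h0 => h𝔟 (Ideal.absNorm_eq_zero_iff.mp h0)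
    exact_mod_cast Nat.pos_of_ne_zero this
  refine real_main (Ideal.absNorm 𝔟 : ℝ) hN h hh a hapos (fun i => by rw [hc, pera])
    (fun i => ι (w i)) (fun i => ι (conj (w i))) hwgt (by simpa only [hw0] using hω'gt)
    (by simpa only [hw0] using hω'lt) (fun i => ?_) (fun i => ?_)
    (fun i => by rw [hc, perw]) (fun i => by rw [hc, perw]) α β hαm2 hαm1 hα0 hβm2 hβm1 hβ0
    hαrec hβrec Q (by simpa only [hw0] using hQ) k Z hZhol hZeq
  · show ι (w i) = _
    rw [hwrec i]
    simp
  · show ι (conj (w i)) = _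
    rw [hwrec i]
    simp

end
end

section
/- Let K be a real quadratic field and 𝔟 a nonzero integral ideal of O_K with 𝔟⁻¹ = ℤ + ℤω, where ω > 1 and −1 < ω′ < 0. Let ε be the totally positive fundamental unit of K, and write ε = p + qω with integers p, q (this is possible since ε ∈ 𝔟⁻¹; moreover p, q > 0 and gcd(p,q) = 1). Let σ = σ((0,1),(q,p)) and Q(m₁,m₂) := N(𝔟)·(m₁ω + m₂)(m₁ω′ + m₂). Then for every s ∈ ℂ with Re(s) > 1: the family (N(𝔞)^{−s}), indexed by the nonzero integral ideals 𝔞 of O_K that are narrowly equivalent to 𝔟, is summable, and Σ_{𝔞} N(𝔞)^{−s} = Σ_{m ∈ ℤ², wt_σ(m) ≠ 0} wt_σ(m)·Q(m)^{−s}, where Q(m)^{−s} := exp(−s·log Q(m)). -/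
open NumberField
open scoped nonZeroDivisors
open Classical

noncomputable section

/-- The half-open cone (including the ray through `(0,1)`). -/
def coneC (p q : ℤ) : Set (ℤ × ℤ) := {m | 0 ≤ m.1 ∧ p * m.1 < q * m.2}

/-- The ray through `(0,1)`. -/
def rayA : Set (ℤ × ℤ) := Set.range (fun n : ℕ => ((0 : ℤ), (n : ℤ) + 1))

/-- The ray through `(q,p)`. -/
def rayB (p q : ℤ) : Set (ℤ × ℤ) :=
  Set.range (fun n : ℕ => (q * ((n : ℤ) + 1), p * ((n : ℤ) + 1)))

theorem mem_rayA_iff (m : ℤ × ℤ) : m ∈ rayA ↔ m.1 = 0 ∧ 0 < m.2 := by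
  constructor
  · rintro ⟨n, rfl⟩
    exact ⟨rfl, by positivity⟩
  · rintro ⟨h1, h2⟩
    refine ⟨(m.2 - 1).toNat, ?_⟩
    ext
    · simp [h1]
    · simp only
      omega

theorem mem_rayB_iff (p q : ℤ) (hq : 0 < q) (hpq : IsCoprime p q) (m : ℤ × ℤ) :
    m ∈ rayB p q ↔ 0 < m.1 ∧ p * m.1 = q * m.2 := by
  constructor
  · rintro ⟨n, rfl⟩
    exact ⟨by positivity, by simp only; ring⟩
  · rintro ⟨h1, h2⟩
    have hd : q ∣ m.1 := hpq.symm.dvd_of_dvd_mul_left ⟨m.2, h2⟩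
    obtain ⟨k, hk⟩ := hd
    have hk0 : 0 < k := by
      rw [hk] at h1
      exact pos_of_mul_pos_right h1 hq.le
    have hm2 : m.2 = p * k := by
      have : q * m.2 = q * (p * k) := by rw [← h2, hk]; ring
      exact mul_left_cancel₀ hq.ne' this
    refine ⟨(k - 1).toNat, ?_⟩
    have : (((k - 1).toNat : ℕ) : ℤ) + 1 = k := by omega
    ext
    · simp only [this, hk]
    · simp only [this, hm2]

theorem wt_eq_s2 (p q : ℤ) (hp : 0 < p) (hq : 0 < q) (hpq : IsCoprime p q) (m : ℤ × ℤ) :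
    wt (0, 1) ((q : ℝ), (p : ℝ)) m =
      (coneC p q).indicator 1 m - (1 / 2) * rayA.indicator 1 m
        + (1 / 2) * (rayB p q).indicator 1 m := by
  have hqR : (0 : ℝ) < q := by exact_mod_cast hq
  have hpR : (0 : ℝ) < p := by exact_mod_cast hp
  have h1 : (∃ x₁ x₂ : ℝ, 0 < x₁ ∧ 0 < x₂ ∧ ((m.1 : ℝ), (m.2 : ℝ)) =
      x₁ • ((0 : ℝ), (1 : ℝ)) + x₂ • ((q : ℝ), (p : ℝ))) ↔ 0 < m.1 ∧ p * m.1 < q * m.2 := by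
    constructor
    · rintro ⟨x, y, hx, hy, h⟩
      simp only [Prod.smul_mk, smul_eq_mul, Prod.mk_add_mk, Prod.mk.injEq] at h
      obtain ⟨ha, hb⟩ := h
      constructor
      · have : (0 : ℝ) < m.1 := by rw [ha]; simp only [mul_zero, zero_add]; positivity
        exact_mod_cast this
      · have : (p : ℝ) * m.1 < q * m.2 := by
          rw [ha, hb]
          have := mul_pos hqR hx
          linarith
        exact_mod_cast this
    · rintro ⟨ha, hb⟩
      have ha' : (0 : ℝ) < m.1 := by exact_mod_cast ha
      have hb' : (p : ℝ) * m.1 < q * m.2 := by exact_mod_cast hb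
      refine ⟨(q * m.2 - p * m.1) / q, m.1 / q, div_pos (by linarith) hqR, div_pos ha' hqR, ?_⟩
      simp only [Prod.smul_mk, smul_eq_mul, Prod.mk_add_mk, Prod.mk.injEq]
      constructor
      · field_simp; ring
      · field_simp; ring
  have h2 : (∃ t : ℝ, 0 < t ∧
      (((m.1 : ℝ), (m.2 : ℝ)) = t • ((0 : ℝ), (1 : ℝ)) ∨
        ((m.1 : ℝ), (m.2 : ℝ)) = t • ((q : ℝ), (p : ℝ)))) ↔
      (m ∈ rayA ∨ m ∈ rayB p q) := by
    rw [mem_rayA_iff, mem_rayB_iff p q hq hpq]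
    constructor
    · rintro ⟨t, ht, h | h⟩
      · left
        simp only [Prod.smul_mk, smul_eq_mul, Prod.mk.injEq, mul_zero, mul_one] at h
        exact ⟨by exact_mod_cast h.1, by have := h.2 ▸ ht; exact_mod_cast this⟩
      · right
        simp only [Prod.smul_mk, smul_eq_mul, Prod.mk.injEq] at h
        constructor
        · have : (0 : ℝ) < m.1 := by rw [h.1]; positivity
          exact_mod_cast this
        · have : (p : ℝ) * m.1 = q * m.2 := by rw [h.1, h.2]; ring
          exact_mod_cast this
    · rintro (⟨ha, hb⟩ | ⟨ha, hb⟩)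
      · exact ⟨m.2, by exact_mod_cast hb, Or.inl (by simp [ha])⟩
      · have ha' : (0 : ℝ) < m.1 := by exact_mod_cast ha
        have hb' : (p : ℝ) * m.1 = q * m.2 := by exact_mod_cast hb
        refine ⟨m.1 / q, div_pos ha' hqR, Or.inr ?_⟩
        simp only [Prod.smul_mk, smul_eq_mul, Prod.mk.injEq]
        constructor
        · field_simp
        · field_simp; linarith
  unfold wt
  simp only [h1, h2, Set.indicator_apply, Pi.one_apply]
  by_cases hA : m ∈ rayA
  · have hA' := (mem_rayA_iff m).1 hA
    have hB : m ∉ rayB p q := by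
      rw [mem_rayB_iff p q hq hpq]; rintro ⟨h, -⟩; omega
    have hC : m ∈ coneC p q := ⟨hA'.1.ge, by rw [hA'.1]; simpa using mul_pos hq hA'.2⟩
    have hI : ¬ (0 < m.1 ∧ p * m.1 < q * m.2) := by rintro ⟨h, -⟩; omega
    simp only [hA, hB, hC, hI, if_true, if_false, true_or]; norm_num
  · by_cases hB : m ∈ rayB p q
    · have hB' := (mem_rayB_iff p q hq hpq m).1 hB
      have hC : m ∉ coneC p q := by rintro ⟨_, h⟩; omega
      have hI : ¬ (0 < m.1 ∧ p * m.1 < q * m.2) := by rintro ⟨_, h⟩; omega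
      simp only [hA, hB, hC, hI, if_true, if_false, or_true]; norm_num
    · have hCI : m ∈ coneC p q ↔ (0 < m.1 ∧ p * m.1 < q * m.2) := by
        constructor
        · rintro ⟨h, h'⟩
          refine ⟨lt_of_le_of_ne h ?_, h'⟩
          intro h0
          apply hA
          rw [mem_rayA_iff]
          refine ⟨h0.symm, ?_⟩
          rw [← h0, mul_zero] at h'
          exact pos_of_mul_pos_right h' hq.le
        · rintro ⟨h, h'⟩
          exact ⟨h.le, h'⟩
      simp only [hA, hB, hCI, if_false, or_false]; norm_num

theorem summable_norm_prod {k : ℝ} (hk : 2 < k) :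
    Summable fun m : ℤ × ℤ => (max |(m.1 : ℝ)| |(m.2 : ℝ)|) ^ (-k) := by
  have h := EisensteinSeries.summable_one_div_norm_rpow hk
  rw [← (finTwoArrowEquiv ℤ).symm.summable_iff] at h
  refine h.congr fun m => ?_
  simp only [Function.comp_apply, finTwoArrowEquiv_symm_apply]
  congr 1
  rw [EisensteinSeries.norm_eq_max_natAbs]
  simp [Nat.cast_natAbs]

/-- Lower bound for the form on the closed cone. -/
theorem form_lower (w w' : ℝ) (p q : ℤ) (hp : 0 < p) (hq : 0 < q) (hw : 1 < w)
    (he' : 0 < p + q * w') :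
    ∃ c : ℝ, 0 < c ∧ ∀ m : ℤ × ℤ, 0 ≤ m.1 → p * m.1 ≤ q * m.2 →
      max |(m.1 : ℝ)| |(m.2 : ℝ)| ≤ m.1 * w + m.2 ∧
      c * max |(m.1 : ℝ)| |(m.2 : ℝ)| ≤ m.1 * w' + m.2 := by
  have hqR : (0 : ℝ) < q := by exact_mod_cast hq
  have hpR : (0 : ℝ) < p := by exact_mod_cast hp
  set e := (p : ℝ) + q * w' with he
  refine ⟨min 1 (e / (p + q)), by positivity, ?_⟩
  intro m h1 h2
  have h1' : (0 : ℝ) ≤ m.1 := by exact_mod_cast h1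
  have h2' : (p : ℝ) * m.1 ≤ q * m.2 := by exact_mod_cast h2
  have h3 : (0 : ℝ) ≤ m.2 := by
    have : 0 ≤ (q : ℝ) * m.2 := le_trans (by positivity) h2'
    exact nonneg_of_mul_nonneg_right this hqR
  rw [abs_of_nonneg h1', abs_of_nonneg h3]
  refine ⟨max_le (by nlinarith) (by nlinarith), ?_⟩
  set c := min 1 (e / (p + q)) with hc
  have hc0 : 0 < c := by positivity
  have hc1 : c ≤ 1 := min_le_left _ _
  have hc2 : c * (p + q) ≤ e := by
    have : c ≤ e / (p + q) := min_le_right _ _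
    rwa [le_div_iff₀ (by positivity)] at this
  have hM : q * max (m.1 : ℝ) (m.2 : ℝ) ≤ (q * m.2 - p * m.1) + (p + q) * m.1 := by
    rw [mul_max_of_nonneg _ _ hqR.le]
    refine max_le (by nlinarith) (by nlinarith)
  have key : q * (c * max (m.1 : ℝ) (m.2 : ℝ)) ≤ q * (m.1 * w' + m.2) := by
    have e1 : q * (m.1 * w' + m.2) = (q * m.2 - p * m.1) + e * m.1 := by rw [he]; ring
    rw [e1]
    calc q * (c * max (m.1 : ℝ) (m.2 : ℝ)) = c * (q * max (m.1 : ℝ) (m.2 : ℝ)) := by ring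
      _ ≤ c * ((q * m.2 - p * m.1) + (p + q) * m.1) := by gcongr
      _ = c * (q * m.2 - p * m.1) + (c * (p + q)) * m.1 := by ring
      _ ≤ 1 * (q * m.2 - p * m.1) + e * m.1 := by
        gcongr
      _ = _ := by ring
  exact le_of_mul_le_mul_left key hqR

/-- The summand. -/
def gterm (N w w' : ℝ) (s : ℂ) (m : ℤ × ℤ) : ℂ :=
  Complex.exp (-s * Complex.log
    ((N * ((m.1 : ℝ) * w + (m.2 : ℝ)) * ((m.1 : ℝ) * w' + (m.2 : ℝ)) : ℝ)))

/-- The closed cone minus the origin. -/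
def coneD (p q : ℤ) : Set (ℤ × ℤ) := {m | 0 ≤ m.1 ∧ p * m.1 ≤ q * m.2 ∧ m ≠ 0}

theorem coneC_sub (p q : ℤ) : coneC p q ⊆ coneD p q := by
  rintro m ⟨h1, h2⟩
  refine ⟨h1, h2.le, ?_⟩
  rintro rfl
  simp at h2

theorem rayA_sub (p q : ℤ) (hq : 0 < q) : rayA ⊆ coneC p q := by
  intro m hm
  rw [mem_rayA_iff] at hm
  exact ⟨hm.1.ge, by rw [hm.1]; simpa using mul_pos hq hm.2⟩

theorem rayB_sub (p q : ℤ) (hq : 0 < q) (hpq : IsCoprime p q) : rayB p q ⊆ coneD p q := by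
  intro m hm
  rw [mem_rayB_iff p q hq hpq] at hm
  refine ⟨hm.1.le, hm.2.le, ?_⟩
  rintro rfl
  simp at hm

theorem summable_D (N w w' : ℝ) (hN : 0 < N) (p q : ℤ) (hp : 0 < p) (hq : 0 < q) (hw : 1 < w)
    (he' : 0 < p + q * w') (s : ℂ) (hs : 1 < s.re) :
    Summable ((coneD p q).indicator (gterm N w w' s)) := by
  obtain ⟨c, hc, hb⟩ := form_lower w w' p q hp hq hw he'
  have h0 := (summable_norm_prod (k := 2 * s.re) (by linarith)).mul_left ((N * c) ^ (-s.re))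
  refine Summable.of_norm_bounded h0 fun m => ?_
  by_cases hm : m ∈ coneD p q
  · rw [Set.indicator_of_mem hm]
    obtain ⟨h1, h2, h3⟩ := hm
    obtain ⟨ha, hb⟩ := hb m h1 h2
    set M := max |(m.1 : ℝ)| |(m.2 : ℝ)| with hM
    have hM0 : 0 < M := by
      rw [hM, lt_max_iff]
      by_contra hcon
      simp only [abs_pos, not_or, not_not] at hcon
      apply h3
      ext
      · exact_mod_cast hcon.1
      · exact_mod_cast hcon.2
    set y := (m.1 : ℝ) * w + (m.2 : ℝ) with hy
    set y' := (m.1 : ℝ) * w' + (m.2 : ℝ) with hy'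
    have hcM : 0 < c * M := by positivity
    have hy0 : 0 < y := lt_of_lt_of_le hM0 ha
    have hy0' : 0 < y' := lt_of_lt_of_le hcM hb
    have hQ : 0 < N * y * y' := by positivity
    have hle : N * c * M ^ (2 : ℝ) ≤ N * y * y' := by
      rw [Real.rpow_two]
      calc N * c * M ^ 2 = N * (M * (c * M)) := by ring
        _ ≤ N * (y * y') := by gcongr
        _ = _ := by ring
    unfold gterm
    rw [← hy, ← hy', ← Complex.ofReal_log hQ.le, Complex.norm_exp]
    have : (-s * (Real.log (N * y * y') : ℂ)).re = Real.log (N * y * y') * (-s.re) := by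
      simp [mul_comm]
    rw [this, ← Real.rpow_def_of_pos hQ]
    calc (N * y * y') ^ (-s.re) ≤ (N * c * M ^ (2 : ℝ)) ^ (-s.re) :=
          Real.rpow_le_rpow_of_nonpos (by positivity) hle (by linarith)
      _ = (N * c) ^ (-s.re) * M ^ (-(2 * s.re)) := by
          rw [Real.mul_rpow (by positivity) (by positivity), ← Real.rpow_mul hM0.le]
          congr 2; ring
  · rw [Set.indicator_of_notMem hm, norm_zero]
    positivity

theorem summable_sub {D S : Set (ℤ × ℤ)} (h : S ⊆ D) {g : ℤ × ℤ → ℂ}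
    (hg : Summable (D.indicator g)) : Summable (S.indicator g) := by
  have := hg.indicator S
  rwa [Set.indicator_indicator, Set.inter_eq_left.2 h] at this

theorem cone_sum (N w w' : ℝ) (hN : 0 < N) (p q : ℤ) (hp : 0 < p) (hq : 0 < q)
    (hpq : IsCoprime p q) (hw : 1 < w)
    (he' : 0 < p + q * w') (hee : (p + q * w) * (p + q * w') = 1) (s : ℂ) (hs : 1 < s.re) :
    ∑' m : ℤ × ℤ, (wt (0, 1) ((q : ℝ), (p : ℝ)) m : ℂ) * gterm N w w' s m =
      ∑' m : coneC p q, gterm N w w' s m := by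
  have hD := summable_D N w w' hN p q hp hq hw he' s hs
  have hC := summable_sub (coneC_sub p q) hD
  have hA := summable_sub ((rayA_sub p q hq).trans (coneC_sub p q)) hD
  have hB := summable_sub (rayB_sub p q hq hpq) hD
  have hAB : ∑' m, rayA.indicator (gterm N w w' s) m =
      ∑' m, (rayB p q).indicator (gterm N w w' s) m := by
    rw [← tsum_subtype, ← tsum_subtype]
    unfold rayA rayB
    rw [tsum_range, tsum_range]
    · refine tsum_congr fun n => ?_
      unfold gterm
      congr 4
      simp only
      push_cast
      linear_combination (-N * (n + 1) ^ 2) * hee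
    · intro a b h
      simp only [Prod.mk.injEq] at h
      have := mul_left_cancel₀ hq.ne' h.1
      omega
    · intro a b h
      simp only [Prod.mk.injEq] at h
      omega
  have hexp : ∀ m : ℤ × ℤ, (wt (0, 1) ((q : ℝ), (p : ℝ)) m : ℂ) * gterm N w w' s m =
      (coneC p q).indicator (gterm N w w' s) m - (1 / 2) * rayA.indicator (gterm N w w' s) m
        + (1 / 2) * (rayB p q).indicator (gterm N w w' s) m := by
    intro m
    rw [wt_eq_s2 p q hp hq hpq]
    simp only [Set.indicator_apply, Pi.one_apply]
    split_ifs <;> push_cast <;> ring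
  simp_rw [hexp]
  rw [Summable.tsum_add (hC.sub (hA.mul_left _)) (hB.mul_left _),
    Summable.tsum_sub hC (hA.mul_left _), tsum_mul_left, tsum_mul_left, hAB, tsum_subtype]
  ring

/-- Characterisation of the half-open cone. -/
theorem mem_coneC_iff (w w' : ℝ) (p q : ℤ) (hp : 0 < p) (hq : 0 < q) (hw : 1 < w) (hw' : w' < 0)
    (he' : 0 < p + q * w') (m : ℤ × ℤ) :
    m ∈ coneC p q ↔ (0 < m.1 * w + m.2 ∧ 0 < m.1 * w' + m.2 ∧
      m.1 * w' + m.2 ≤ m.1 * w + m.2 ∧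
      (p + q * w') * (m.1 * w + m.2) < (p + q * w) * (m.1 * w' + m.2)) := by
  have hid : (p + q * w) * (m.1 * w' + m.2) - (p + q * w') * (m.1 * w + m.2) =
    (w - w') * (q * m.2 - p * m.1) := by ring
  have hww : 0 < w - w' := by linarith
  constructor
  · intro hm
    obtain ⟨c, hc, hb⟩ := form_lower w w' p q hp hq hw he'
    obtain ⟨h1, h2, h3⟩ := coneC_sub p q hm
    obtain ⟨ha, hb⟩ := hb m h1 h2
    have hM0 : 0 < max |(m.1 : ℝ)| |(m.2 : ℝ)| := by
      rw [lt_max_iff]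
      by_contra hcon
      simp only [abs_pos, not_or, not_not] at hcon
      apply h3
      ext
      · exact_mod_cast hcon.1
      · exact_mod_cast hcon.2
    refine ⟨hM0.trans_le ha, (mul_pos hc hM0).trans_le hb, ?_, ?_⟩
    · have : (0 : ℝ) ≤ m.1 := by exact_mod_cast h1
      nlinarith
    · have : (p : ℝ) * m.1 < q * m.2 := by exact_mod_cast hm.2
      have := mul_pos hww (sub_pos.2 this)
      linarith
  · rintro ⟨-, -, h1, h2⟩
    constructor
    · have : 0 ≤ (w - w') * m.1 := by linarith
      have := nonneg_of_mul_nonneg_right this hww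
      exact_mod_cast this
    · have : 0 < (w - w') * (q * m.2 - p * m.1) := by linarith
      have : (p : ℝ) * m.1 < q * m.2 := sub_pos.1 (pos_of_mul_pos_right this hww.le)
      exact_mod_cast this

theorem norm_eq_conj (K : Type) [Field K] [NumberField K] (hdeg : Module.finrank ℚ K = 2)
    (ι : K →+* ℝ) (conj : K ≃ₐ[ℚ] K) (hconj : conj ≠ AlgEquiv.refl) (x : K) :
    ((Algebra.norm ℚ x : ℚ) : ℝ) = ι x * ι (conj x) := by
  have hle : Fintype.card (K ≃ₐ[ℚ] K) ≤ 2 := hdeg ▸ AlgEquiv.card_le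
  have hpair : ({AlgEquiv.refl, conj} : Finset (K ≃ₐ[ℚ] K)).card = 2 :=
    Finset.card_pair hconj.symm
  have huniv : ({AlgEquiv.refl, conj} : Finset (K ≃ₐ[ℚ] K)) = Finset.univ := by
    apply Finset.eq_univ_of_card
    have := Finset.card_le_univ ({AlgEquiv.refl, conj} : Finset (K ≃ₐ[ℚ] K))
    omega
  have hcard : Nat.card (K ≃ₐ[ℚ] K) = Module.finrank ℚ K := by
    rw [Nat.card_eq_fintype_card, ← Finset.card_univ, ← huniv, hpair, hdeg]
  have hgal : IsGalois ℚ K := IsGalois.of_card_aut_eq_finrank ℚ K hcard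
  have h := Algebra.norm_eq_prod_automorphisms ℚ x
  rw [← huniv, Finset.prod_pair hconj.symm] at h
  have h2 := congrArg ι h
  rw [map_mul] at h2
  simpa using h2

/- STATEMENT 2: for Re(s) > 1, the partial zeta series of the narrow class of 𝔟 is summable
and equals the lattice-cone sum of the quadratic form Q weighted by wt_σ. -/
theorem stmt_2
    -- K is a real quadratic field with nontrivial automorphism `conj` and real embedding `ι`
    (K : Type) [Field K] [NumberField K] (hdeg : Module.finrank ℚ K = 2)
    (ι : K →+* ℝ) (conj : K ≃ₐ[ℚ] K) (hconj : conj ≠ AlgEquiv.refl)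
    -- 𝔟 is a nonzero integral ideal with 𝔟⁻¹ = ℤ + ℤω
    (𝔟 : Ideal (𝓞 K)) (h𝔟 : 𝔟 ≠ 0) (ω : K)
    (hinv : ∀ x : K, x ∈ ((𝔟 : FractionalIdeal (𝓞 K)⁰ K))⁻¹ ↔
      ∃ c d : ℤ, x = (c : K) + (d : K) * ω)
    (hω1 : 1 < ι ω) (hω'gt : -1 < ι (conj ω)) (hω'lt : ι (conj ω) < 0)
    -- ε is the totally positive fundamental unit of K
    (ε : K) (hεunit : ∃ u : (𝓞 K)ˣ, ((u : 𝓞 K) : K) = ε)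
    (hε1 : 1 < ι ε) (hεpos : 0 < ι ε) (hε'pos : 0 < ι (conj ε))
    (hεfund : ∀ u : (𝓞 K)ˣ, 0 < ι ((u : 𝓞 K) : K) → 0 < ι (conj ((u : 𝓞 K) : K)) →
      ∃ m : ℤ, ((u : 𝓞 K) : K) = ε ^ m)
    -- ε = p + qω with p, q positive coprime integers
    (p q : ℤ) (hεpq : ε = (p : K) + (q : K) * ω) (hp : 0 < p) (hq : 0 < q)
    (hpq : IsCoprime p q) :
    ∀ s : ℂ, 1 < s.re →
      Summable (fun 𝔞 : {𝔞 : Ideal (𝓞 K) // 𝔞 ≠ 0 ∧ ∃ x : K, 0 < ι x ∧ 0 < ι (conj x) ∧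
          (𝔟 : FractionalIdeal (𝓞 K)⁰ K) =
            FractionalIdeal.spanSingleton (𝓞 K)⁰ x * ((𝔞 : Ideal (𝓞 K)) : FractionalIdeal (𝓞 K)⁰ K)} =>
        Complex.exp (-s * Complex.log ((Ideal.absNorm (𝔞 : Ideal (𝓞 K)) : ℝ)))) ∧
      (∑' 𝔞 : {𝔞 : Ideal (𝓞 K) // 𝔞 ≠ 0 ∧ ∃ x : K, 0 < ι x ∧ 0 < ι (conj x) ∧
          (𝔟 : FractionalIdeal (𝓞 K)⁰ K) =
            FractionalIdeal.spanSingleton (𝓞 K)⁰ x * ((𝔞 : Ideal (𝓞 K)) : FractionalIdeal (𝓞 K)⁰ K)},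
        Complex.exp (-s * Complex.log ((Ideal.absNorm (𝔞 : Ideal (𝓞 K)) : ℝ))))
      = ∑' m : ℤ × ℤ,
          (wt (0, 1) ((q : ℝ), (p : ℝ)) m : ℂ) *
            Complex.exp (-s * Complex.log
              (((Ideal.absNorm 𝔟 : ℝ) * ((m.1 : ℝ) * ι ω + (m.2 : ℝ)) *
                ((m.1 : ℝ) * ι (conj ω) + (m.2 : ℝ)) : ℝ))) := by
  intro s hs
  set w := ι ω with hw
  set w' := ι (conj ω) with hw'
  have hN : 0 < (Ideal.absNorm 𝔟 : ℝ) := by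
    have : Ideal.absNorm 𝔟 ≠ 0 := by rwa [Ne, Ideal.absNorm_eq_zero_iff]
    exact_mod_cast Nat.pos_of_ne_zero this
  have hnorm := norm_eq_conj K hdeg ι conj hconj
  obtain ⟨u, hu⟩ := hεunit
  have hεe : ι ε = p + q * w := by rw [hεpq]; simp [hw]
  have hεe' : ι (conj ε) = p + q * w' := by rw [hεpq]; simp [hw']
  have hee1 : ι ε * ι (conj ε) = 1 := by
    have h1 := (NumberField.isUnit_iff_norm (x := (u : 𝓞 K))).1 u.isUnit
    rw [RingOfIntegers.coe_norm, hu] at h1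
    have h2 : |((Algebra.norm ℚ ε : ℚ) : ℝ)| = 1 := by exact_mod_cast h1
    rwa [hnorm, abs_of_pos (mul_pos hεpos hε'pos)] at h2
  have hee : (p + q * w) * (p + q * w') = 1 := by rw [← hεe, ← hεe', hee1]
  have he'pos : 0 < p + q * w' := by rw [← hεe']; exact hε'pos
  have hε0 : ε ≠ 0 := by rintro rfl; simp at hεpos
  have hinve : ι (conj ε) = (ι ε)⁻¹ := eq_inv_of_mul_eq_one_right hee1
  have h𝔟0 : (𝔟 : FractionalIdeal (𝓞 K)⁰ K) ≠ 0 := by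
    rwa [Ne, FractionalIdeal.coeIdeal_eq_zero]
  let Y : ℤ × ℤ → K := fun m => (m.1 : K) * ω + (m.2 : K)
  have hY : ∀ m, ι (Y m) = m.1 * w + m.2 := by intro m; simp [Y, hw]
  have hY' : ∀ m, ι (conj (Y m)) = m.1 * w' + m.2 := by intro m; simp [Y, hw']
  have hYinv : ∀ m, Y m ∈ ((𝔟 : FractionalIdeal (𝓞 K)⁰ K))⁻¹ := fun m =>
    (hinv _).2 ⟨m.2, m.1, by simp only [Y]; ring⟩
  have hYinj : ∀ m n, Y m = Y n → m = n := by
    intro m n h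
    have h1 := congrArg ι h
    have h2 := congrArg (fun x => ι (conj x)) h
    simp only [hY, hY'] at h1 h2
    have h3 : (w - w') * ((m.1 : ℝ) - n.1) = 0 := by linear_combination h1 - h2
    have h4 : (m.1 : ℝ) - n.1 = 0 := by
      rcases mul_eq_zero.1 h3 with h | h
      · linarith
      · exact h
    have h5 : (m.1 : ℝ) = n.1 := by linarith
    have h6 : (m.2 : ℝ) = n.2 := by rw [h5] at h1; linarith
    ext
    · exact_mod_cast h5
    · exact_mod_cast h6
  have hmem : ∀ m, m ∈ coneC p q ↔ (0 < ι (Y m) ∧ 0 < ι (conj (Y m)) ∧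
      ι (conj (Y m)) ≤ ι (Y m) ∧ ι (conj ε) * ι (Y m) < ι ε * ι (conj (Y m))) := by
    intro m
    rw [hY, hY', hεe, hεe']
    exact mem_coneC_iff w w' p q hp hq hω1 hω'lt he'pos m
  let T := {𝔞 : Ideal (𝓞 K) // 𝔞 ≠ 0 ∧ ∃ x : K, 0 < ι x ∧ 0 < ι (conj x) ∧
          (𝔟 : FractionalIdeal (𝓞 K)⁰ K) =
            FractionalIdeal.spanSingleton (𝓞 K)⁰ x * ((𝔞 : Ideal (𝓞 K)) : FractionalIdeal (𝓞 K)⁰ K)}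
  have hex : ∀ m : coneC p q, ∃ 𝔞 : T, ((𝔞 : Ideal (𝓞 K)) : FractionalIdeal (𝓞 K)⁰ K) =
      FractionalIdeal.spanSingleton (𝓞 K)⁰ (Y m) * (𝔟 : FractionalIdeal (𝓞 K)⁰ K) := by
    intro m
    obtain ⟨h1, h2, -, -⟩ := (hmem m).1 m.2
    have hY0 : Y m ≠ 0 := by intro h; rw [h] at h1; simp at h1
    have hle : FractionalIdeal.spanSingleton (𝓞 K)⁰ (Y m) * (𝔟 : FractionalIdeal (𝓞 K)⁰ K) ≤ 1 := by
      have : FractionalIdeal.spanSingleton (𝓞 K)⁰ (Y m) ≤ (𝔟 : FractionalIdeal (𝓞 K)⁰ K)⁻¹ := by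
        rw [FractionalIdeal.spanSingleton_le_iff_mem]
        exact hYinv m
      calc _ ≤ (𝔟 : FractionalIdeal (𝓞 K)⁰ K)⁻¹ * (𝔟 : FractionalIdeal (𝓞 K)⁰ K) := by gcongr
        _ = 1 := inv_mul_cancel₀ h𝔟0
    obtain ⟨I, hI⟩ := FractionalIdeal.le_one_iff_exists_coeIdeal.1 hle
    refine ⟨⟨I, ?_, (Y m)⁻¹, ?_, ?_, ?_⟩, hI⟩
    · intro h0
      rw [h0] at hI
      have h3 : FractionalIdeal.spanSingleton (𝓞 K)⁰ (Y m) * (𝔟 : FractionalIdeal (𝓞 K)⁰ K) = 0 := by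
        rw [← hI]; simp
      rcases mul_eq_zero.1 h3 with h | h
      · exact hY0 (FractionalIdeal.spanSingleton_eq_zero_iff.1 h)
      · exact h𝔟0 h
    · rw [map_inv₀]; positivity
    · rw [map_inv₀, map_inv₀]; positivity
    · rw [hI, ← mul_assoc, FractionalIdeal.spanSingleton_mul_spanSingleton, inv_mul_cancel₀ hY0,
        FractionalIdeal.spanSingleton_one, one_mul]
  choose Φ hΦ using hex
  have hΦinj : Function.Injective Φ := by
    intro m n hmn
    have h1 : FractionalIdeal.spanSingleton (𝓞 K)⁰ (Y m) * (𝔟 : FractionalIdeal (𝓞 K)⁰ K) =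
        FractionalIdeal.spanSingleton (𝓞 K)⁰ (Y n) * (𝔟 : FractionalIdeal (𝓞 K)⁰ K) := by
      rw [← hΦ, ← hΦ, hmn]
    have h2 := mul_right_cancel₀ h𝔟0 h1
    obtain ⟨z, hz⟩ := FractionalIdeal.spanSingleton_eq_spanSingleton.1 h2
    have hz' : ((z : 𝓞 K) : K) * Y m = Y n := by
      rw [← hz, Units.smul_def, Algebra.smul_def]
    obtain ⟨m1, m2, m3, m4⟩ := (hmem m).1 m.2
    obtain ⟨n1, n2, n3, n4⟩ := (hmem n).1 n.2
    have hz1 : 0 < ι ((z : 𝓞 K) : K) := by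
      rw [← hz', map_mul] at n1
      exact pos_of_mul_pos_left n1 m1.le
    have hz2 : 0 < ι (conj ((z : 𝓞 K) : K)) := by
      rw [← hz', map_mul, map_mul] at n2
      exact pos_of_mul_pos_left n2 m2.le
    obtain ⟨k, hk⟩ := hεfund z hz1 hz2
    rw [hk] at hz'
    have hk0 : k = 0 := by
      rw [← hz'] at n3 n4
      simp only [map_mul, map_zpow₀, hinve, inv_zpow] at n3 n4 m3 m4
      set e := ι ε with hedef
      set y := ι (Y m) with hy
      set y' := ι (conj (Y m)) with hy'
      have hek : 0 < e ^ k := by positivity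
      have m4' : y < e * e * y' := by
        have := mul_lt_mul_of_pos_left m4 hεpos
        rwa [← mul_assoc, mul_inv_cancel₀ hεpos.ne', one_mul, ← mul_assoc] at this
      have n3' : y' ≤ e ^ k * e ^ k * y := by
        have := mul_le_mul_of_nonneg_left n3 hek.le
        rwa [← mul_assoc, mul_inv_cancel₀ hek.ne', one_mul, ← mul_assoc] at this
      have n4' : e ^ k * e ^ k * y < e * e * y' := by
        have := mul_lt_mul_of_pos_left n4 (mul_pos hek hεpos)
        have e1 : e ^ k * e * (e⁻¹ * (e ^ k * y)) = e ^ k * e ^ k * y := by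
          field_simp
        have e2 : e ^ k * e * (e * ((e ^ k)⁻¹ * y')) = e * e * y' := by
          field_simp
        rwa [e1, e2] at this
      have hkk : e ^ k * e ^ k = e ^ (2 * k) := by
        rw [two_mul, zpow_add₀ hεpos.ne']
      have h22 : e * e = e ^ (2 : ℤ) := by
        rw [zpow_ofNat, sq]
      rw [hkk] at n3' n4'
      rw [h22] at n4' m4'
      have b1 : e ^ (2 * k) < e ^ (2 : ℤ) := by
        by_contra hcon
        push Not at hcon
        have : e ^ (2 : ℤ) * y' ≤ e ^ (2 * k) * y := by gcongr
        linarith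
      have b2 : e ^ (-2 : ℤ) < e ^ (2 * k) := by
        by_contra hcon
        push Not at hcon
        have hlt : y' < y' := by
          calc y' ≤ e ^ (2 * k) * y := n3'
            _ ≤ e ^ (-2 : ℤ) * y := by gcongr
            _ < e ^ (-2 : ℤ) * (e ^ (2 : ℤ) * y') := by gcongr
            _ = y' := by
              rw [← mul_assoc, ← zpow_add₀ hεpos.ne']; simp
        exact lt_irrefl _ hlt
      have c1 := (zpow_lt_zpow_iff_right₀ hε1).1 b1
      have c2 := (zpow_lt_zpow_iff_right₀ hε1).1 b2
      omega
    rw [hk0, zpow_zero, one_mul] at hz'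
    exact Subtype.ext (hYinj _ _ hz')
  have hΦsurj : Function.Surjective Φ := by
    rintro ⟨I, hI0, x, hx, hx', hIx⟩
    have hx0 : x ≠ 0 := by rintro rfl; simp at hx
    obtain ⟨n, hn1, hn2⟩ := exists_mem_Ico_zpow (x := ι (conj x) / ι x) (y := ι ε ^ 2)
      (by positivity) (one_lt_pow₀ hε1 (by norm_num))
    set y := x⁻¹ * ε ^ (-n) with hy
    have hspan : (I : FractionalIdeal (𝓞 K)⁰ K) =
        FractionalIdeal.spanSingleton (𝓞 K)⁰ y * (𝔟 : FractionalIdeal (𝓞 K)⁰ K) := by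
      have h1 : FractionalIdeal.spanSingleton (𝓞 K)⁰ x⁻¹ =
          FractionalIdeal.spanSingleton (𝓞 K)⁰ y := by
        rw [FractionalIdeal.spanSingleton_eq_spanSingleton]
        refine ⟨u ^ (-n), ?_⟩
        rw [Units.smul_def, Algebra.smul_def, hy, mul_comm, ← hu]
        congr 1
        exact NumberField.Units.coe_zpow u (-n)
      rw [← h1, hIx, ← mul_assoc, FractionalIdeal.spanSingleton_mul_spanSingleton,
        inv_mul_cancel₀ hx0, FractionalIdeal.spanSingleton_one, one_mul]
    have hyinv : y ∈ ((𝔟 : FractionalIdeal (𝓞 K)⁰ K))⁻¹ := by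
      rw [FractionalIdeal.mem_inv_iff h𝔟0]
      intro b hb
      have h1 : y * b ∈ (I : FractionalIdeal (𝓞 K)⁰ K) := by
        rw [hspan]
        exact FractionalIdeal.mul_mem_mul (FractionalIdeal.mem_spanSingleton_self _ _) hb
      exact FractionalIdeal.coeIdeal_le_one h1
    obtain ⟨c, d, hcd⟩ := (hinv y).1 hyinv
    have hYy : Y (d, c) = y := by rw [hcd]; simp only [Y]; ring
    have hC : (d, c) ∈ coneC p q := by
      rw [hmem, hYy, hy]
      simp only [map_mul, map_zpow₀, map_inv₀, hinve, inv_zpow, zpow_neg, inv_inv]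
      set e := ι ε with hedef
      set a := ι x
      set a' := ι (conj x)
      have hen : 0 < e ^ n := by positivity
      have hen2 : (e ^ 2) ^ n = e ^ n * e ^ n := by
        rw [sq, mul_zpow]
      rw [le_div_iff₀ hx, hen2] at hn1
      rw [div_lt_iff₀ hx, zpow_add₀ (by positivity), zpow_one, hen2] at hn2
      refine ⟨by positivity, by positivity, ?_, ?_⟩
      · rw [← sub_nonneg]
        have : a⁻¹ * (e ^ n)⁻¹ - a'⁻¹ * e ^ n =
            (a' - e ^ n * e ^ n * a) * (a⁻¹ * (e ^ n)⁻¹ * a'⁻¹) := by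
          field_simp
        rw [this]
        exact mul_nonneg (by linarith) (by positivity)
      · rw [← sub_pos]
        have : e * (a'⁻¹ * e ^ n) - e⁻¹ * (a⁻¹ * (e ^ n)⁻¹) =
            (e ^ n * e ^ n * e ^ 2 * a - a') * (a⁻¹ * (e ^ n)⁻¹ * a'⁻¹ * e⁻¹) := by
          field_simp
        rw [this]
        exact mul_pos (by linarith) (by positivity)
    refine ⟨⟨(d, c), hC⟩, ?_⟩
    apply Subtype.ext
    apply FractionalIdeal.coeIdeal_injective (K := K)
    have h1 := hΦ ⟨(d, c), hC⟩
    simp only [hYy] at h1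
    exact h1.trans hspan.symm
  let E : coneC p q ≃ T := Equiv.ofBijective Φ ⟨hΦinj, hΦsurj⟩
  have hterm : ∀ m : coneC p q,
      Complex.exp (-s * Complex.log ((Ideal.absNorm ((E m : T) : Ideal (𝓞 K)) : ℝ))) =
        gterm (Ideal.absNorm 𝔟 : ℝ) w w' s m := by
    intro m
    have h1 := congrArg FractionalIdeal.absNorm (hΦ m)
    rw [map_mul, FractionalIdeal.coeIdeal_absNorm, FractionalIdeal.coeIdeal_absNorm,
      FractionalIdeal.absNorm_span_singleton] at h1
    have h2 : (Ideal.absNorm ((Φ m : T) : Ideal (𝓞 K)) : ℝ) =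
        |((Algebra.norm ℚ (Y m) : ℚ) : ℝ)| * (Ideal.absNorm 𝔟 : ℝ) := by exact_mod_cast h1
    obtain ⟨m1, m2, -, -⟩ := (hmem m).1 m.2
    rw [hnorm, abs_of_pos (mul_pos m1 m2), hY, hY'] at h2
    have h3 : (Ideal.absNorm ((E m : T) : Ideal (𝓞 K)) : ℝ) = (Ideal.absNorm 𝔟 : ℝ) *
      (((m : ℤ × ℤ).1 : ℝ) * w + ((m : ℤ × ℤ).2 : ℝ)) *
        (((m : ℤ × ℤ).1 : ℝ) * w' + ((m : ℤ × ℤ).2 : ℝ)) := by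
      change (Ideal.absNorm ((Φ m : T) : Ideal (𝓞 K)) : ℝ) = _
      rw [h2]; ring
    rw [h3, gterm]
  have hsumC : Summable fun m : coneC p q => gterm (Ideal.absNorm 𝔟 : ℝ) w w' s m :=
    summable_subtype_iff_indicator.2 (summable_sub (coneC_sub p q)
      (summable_D _ w w' hN p q hp hq hω1 he'pos s hs))
  constructor
  · refine (E.summable_iff).1 ?_
    refine hsumC.congr fun m => ?_
    exact (hterm m).symm
  · refine Eq.trans ?_ (cone_sum _ w w' hN p q hp hq hpq hω1 he'pos hee s hs).symm
    refine Eq.trans (E.tsum_eq _).symm ?_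
    exact tsum_congr hterm

end
end
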